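/- The central member of a parallel family of hyperspheres cuts a symmetric convex spherical body in maximal section: let K₀ ⊆ ℝ^n be a bounded symmetric convex set with nonempty interior, K = q(K₀), and let u ∈ ℝ^{n+1} be a unit vector with ⟨u, o⟩ = 0. Then for every t ∈ (-π/2, π/2): μ_{n-1}(K ∩ {y ∈ S^n : ⟨y,u⟩ = 0}) ≥ μ_{n-1}(K ∩ {y ∈ S^n : ⟨y,u⟩ = sin t}), i.e., among the parallel family of hyperspheres {y ∈ S^n : ⟨y,u⟩ = sin t}, the one through the center o maximizes the (n-1)-dimensional volume of the section of K. -/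

import Mathlib

open MeasureTheory Real
open scoped RealInnerProductSpace ENNReal

/-- Density (up to constant) of the Cauchy measure on `ℝⁿ`. -/
noncomputable def cauchyDensity (n : ℕ) (x : EuclideanSpace ℝ (Fin n)) : ℝ :=
  (1 + ‖x‖ ^ 2) ^ (-(((n : ℝ) + 1) / 2))

/-- Normalizing constant of the Cauchy measure. -/
noncomputable def cauchyConst (n : ℕ) : ℝ :=
  (∫ x : EuclideanSpace ℝ (Fin n), cauchyDensity n x)⁻¹

/-- The Cauchy measure `ν_n` on `ℝⁿ`. -/
noncomputable def cauchyMeasure (n : ℕ) : Measure (EuclideanSpace ℝ (Fin n)) :=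
  volume.withDensity fun x => ENNReal.ofReal (cauchyConst n * cauchyDensity n x)

/-- Gnomonic projection of `ℝⁿ` onto the open upper hemisphere of `Sⁿ ⊆ ℝ^{n+1}`. -/
noncomputable def gnomonic (n : ℕ) (x : EuclideanSpace ℝ (Fin n)) :
    EuclideanSpace ℝ (Fin (n + 1)) :=
  (Real.sqrt (1 + ‖x‖ ^ 2))⁻¹ •
    ((EuclideanSpace.equiv (Fin (n + 1)) ℝ).symm (Fin.snoc (fun i => x i) 1))

/-- The pole `o = e_{n+1}`. -/
noncomputable def pole (n : ℕ) : EuclideanSpace ℝ (Fin (n + 1)) :=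
  EuclideanSpace.single (Fin.last n) 1

/-- The unit sphere `Sⁿ ⊆ ℝ^{n+1}` as a set. -/
noncomputable def unitSphereSet (n : ℕ) : Set (EuclideanSpace ℝ (Fin (n + 1))) :=
  Metric.sphere 0 1

/-- The open hemisphere `Sⁿ₊` centered at the pole. -/
noncomputable def hemisphere (n : ℕ) : Set (EuclideanSpace ℝ (Fin (n + 1))) :=
  {y ∈ unitSphereSet n | 0 < ⟪y, pole n⟫}

open Set Filter Topology in
/-- One-dimensional Brunn–Minkowski inequality for compact sets. -/
theorem volume_add_volume_le_volume_add {K L : Set ℝ} (hK : IsCompact K) (hL : IsCompact L)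
    (hK0 : K.Nonempty) (hL0 : L.Nonempty) :
    volume K + volume L ≤ volume (Set.image2 (· + ·) K L) := by
  set a := sSup K
  set b := sInf L
  have ha : a ∈ K := hK.sSup_mem hK0
  have hb : b ∈ L := hL.sInf_mem hL0
  have h1 : volume ((fun x => x + b) '' K) = volume K := by simp
  have h2 : volume ((fun x => a + x) '' L) = volume L := by simp
  have hd : AEDisjoint volume ((fun x => x + b) '' K) ((fun x => a + x) '' L) := by
    refine measure_mono_null (t := {a + b}) ?_ (by simp)
    rintro _ ⟨⟨x, hx, rfl⟩, ⟨y, hy, hxy⟩⟩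
    have := le_csSup hK.bddAbove hx
    have := csInf_le hL.bddBelow hy
    simp only [mem_singleton_iff] at hxy ⊢
    linarith
  rw [← h1, ← h2, ← measure_union₀ _ hd]
  · refine measure_mono (union_subset ?_ ?_)
    · rintro _ ⟨x, hx, rfl⟩
      exact ⟨x, hx, b, hb, rfl⟩
    · rintro _ ⟨x, hx, rfl⟩
      exact ⟨a, ha, x, hx, rfl⟩
  · exact (hL.image (by fun_prop)).measurableSet.nullMeasurableSet

open Set Filter Topology in
open scoped Pointwise in
theorem volume_add_volume_le_of_midpoint_mem {X Y Z : Set ℝ} (hX : MeasurableSet X)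
    (hY : MeasurableSet Y) (hX0 : X.Nonempty) (hY0 : Y.Nonempty)
    (h : ∀ x ∈ X, ∀ y ∈ Y, (1 / 2 : ℝ) • (x + y) ∈ Z) :
    volume X + volume Y ≤ 2 * volume Z := by
  have key : ∀ K ⊆ X, IsCompact K → ∀ L ⊆ Y, IsCompact L →
      volume K + volume L ≤ 2 * volume Z := by
    intro K hKX hK L hLY hL
    obtain ⟨x, hx⟩ := hX0
    obtain ⟨y, hy⟩ := hY0
    have h1 : volume (insert x K) + volume (insert y L) ≤
        volume (Set.image2 (· + ·) (insert x K) (insert y L)) :=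
      volume_add_volume_le_volume_add (hK.insert x) (hL.insert y) (insert_nonempty _ _)
        (insert_nonempty _ _)
    refine (add_le_add (measure_mono (subset_insert _ _)) (measure_mono (subset_insert _ _))).trans
      (h1.trans ?_)
    have h2 : Set.image2 (· + ·) (insert x K) (insert y L) ⊆ (2 : ℝ) • Z := by
      rintro _ ⟨p, hp, q, hq, rfl⟩
      refine ⟨(1 / 2 : ℝ) • (p + q), h p (insert_subset hx hKX hp) q (insert_subset hy hLY hq), ?_⟩
      simp only [smul_eq_mul]
      ring
    refine (measure_mono h2).trans ?_
    rw [Measure.addHaar_smul]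
    simp
  refine le_of_forall_lt fun c hc => ?_
  rcases eq_or_ne (volume X) 0 with hX1 | hX1
  · rw [hX1, zero_add] at hc
    obtain ⟨L, hLY, hL, hcL⟩ := hY.exists_lt_isCompact hc
    exact hcL.trans_le (le_add_self.trans (key ∅ (empty_subset _) isCompact_empty L hLY hL))
  rcases eq_or_ne (volume Y) 0 with hY1 | hY1
  · rw [hY1, add_zero] at hc
    obtain ⟨K, hKX, hK, hcK⟩ := hX.exists_lt_isCompact hc
    exact hcK.trans_le (le_self_add.trans (key K hKX hK ∅ (empty_subset _) isCompact_empty))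
  obtain ⟨a, ha, b, hb, hab⟩ := ENNReal.exists_lt_add_of_lt_add hc hX1 hY1
  obtain ⟨K, hKX, hK, hcK⟩ := hX.exists_lt_isCompact ha
  obtain ⟨L, hLY, hL, hcL⟩ := hY.exists_lt_isCompact hb
  exact hab.trans ((ENNReal.add_lt_add hcK hcL).trans_le (key K hKX hK L hLY hL))

theorem lintegral_add_lintegral_le_of_sup_eq_one {f g h : ℝ → ℝ} (hf : Measurable f)
    (hg : Measurable g) (hh : Measurable h) (hf0 : 0 ≤ f) (hg0 : 0 ≤ g) (hh0 : 0 ≤ h)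
    (hf1 : ∀ x, f x ≤ 1) (hg1 : ∀ x, g x ≤ 1) (hfs : ∀ t < 1, ∃ x, t < f x)
    (hgs : ∀ t < 1, ∃ x, t < g x) (H : ∀ x y, f x * g y ≤ h ((1 / 2 : ℝ) • (x + y)) ^ 2) :
    (∫⁻ x, ENNReal.ofReal (f x)) + ∫⁻ x, ENNReal.ofReal (g x) ≤
      2 * ∫⁻ x, ENNReal.ofReal (h x) := by
  rw [lintegral_eq_lintegral_meas_lt _ (Filter.Eventually.of_forall hf0) hf.aemeasurable,
    lintegral_eq_lintegral_meas_lt _ (Filter.Eventually.of_forall hg0) hg.aemeasurable,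
    lintegral_eq_lintegral_meas_lt _ (Filter.Eventually.of_forall hh0) hh.aemeasurable,
    ← lintegral_const_mul' _ _ (by simp), ← lintegral_add_left]
  · refine setLIntegral_mono' measurableSet_Ioi fun t ht => ?_
    rcases lt_or_ge t 1 with h1 | h1
    · refine volume_add_volume_le_of_midpoint_mem (measurableSet_lt measurable_const hf)
        (measurableSet_lt measurable_const hg) (hfs t h1) (hgs t h1) fun x hx y hy => ?_
      have ht0 : 0 < t := ht
      simp only [Set.mem_ofPred_eq] at hx hy ⊢
      have := H x y
      refine lt_of_pow_lt_pow_left₀ 2 (hh0 _) (lt_of_lt_of_le ?_ this)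
      nlinarith
    · have e1 : {a | t < f a} = ∅ := by
        ext x; simp; linarith [hf1 x]
      have e2 : {a | t < g a} = ∅ := by
        ext x; simp; linarith [hg1 x]
      simp [e1, e2]
  · exact Antitone.measurable fun s t hst => measure_mono fun x hx => lt_of_le_of_lt hst hx

theorem prekopaLeindler_real {f g h : ℝ → ℝ} {N : ℝ} (hf : Measurable f)
    (hg : Measurable g) (hh : Measurable h) (hf0 : 0 ≤ f) (hg0 : 0 ≤ g) (hh0 : 0 ≤ h)
    (hfN : ∀ x, f x ≤ N) (hgN : ∀ x, g x ≤ N)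
    (H : ∀ x y, f x * g y ≤ h ((1 / 2 : ℝ) • (x + y)) ^ 2) :
    (∫⁻ x, ENNReal.ofReal (f x)) * ∫⁻ x, ENNReal.ofReal (g x) ≤
      (∫⁻ x, ENNReal.ofReal (h x)) ^ 2 := by
  have bf : BddAbove (Set.range f) := ⟨N, by rintro _ ⟨x, rfl⟩; exact hfN x⟩
  have bg : BddAbove (Set.range g) := ⟨N, by rintro _ ⟨x, rfl⟩; exact hgN x⟩
  set a := ⨆ x, f x with ha
  set b := ⨆ x, g x with hb
  have hfa : ∀ x, f x ≤ a := le_ciSup bf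
  have hgb : ∀ x, g x ≤ b := le_ciSup bg
  rcases (hf0 0 |>.trans (hfa 0)).eq_or_lt with ha0 | ha0
  · have : ∀ x, ENNReal.ofReal (f x) = 0 := fun x => by
      rw [ENNReal.ofReal_eq_zero]
      exact (hfa x).trans ha0.symm.le
    simp [this]
  rcases (hg0 0 |>.trans (hgb 0)).eq_or_lt with hb0 | hb0
  · have : ∀ x, ENNReal.ofReal (g x) = 0 := fun x => by
      rw [ENNReal.ofReal_eq_zero]
      exact (hgb x).trans hb0.symm.le
    simp [this]
  simp only [Pi.zero_apply] at ha0 hb0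
  set c := √(a * b) with hc
  have hc0 : 0 < c := Real.sqrt_pos.2 (mul_pos ha0 hb0)
  have hc2 : c ^ 2 = a * b := Real.sq_sqrt (mul_pos ha0 hb0).le
  have key := lintegral_add_lintegral_le_of_sup_eq_one (f := fun x => a⁻¹ * f x)
    (g := fun x => b⁻¹ * g x) (h := fun x => c⁻¹ * h x) (by fun_prop) (by fun_prop) (by fun_prop)
    (fun x => mul_nonneg (by positivity) (hf0 x)) (fun x => mul_nonneg (by positivity) (hg0 x))
    (fun x => mul_nonneg (by positivity) (hh0 x))
    (fun x => by rw [inv_mul_le_iff₀ ha0]; simpa using hfa x)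
    (fun x => by rw [inv_mul_le_iff₀ hb0]; simpa using hgb x)
    (fun t ht => by
      obtain ⟨x, hx⟩ := exists_lt_of_lt_ciSup (f := f) (b := a * t) (by nlinarith)
      exact ⟨x, by rwa [lt_inv_mul_iff₀ ha0]⟩)
    (fun t ht => by
      obtain ⟨x, hx⟩ := exists_lt_of_lt_ciSup (f := g) (b := b * t) (by nlinarith)
      exact ⟨x, by rwa [lt_inv_mul_iff₀ hb0]⟩)
    (fun x y => by
      rw [mul_pow, inv_pow, hc2, mul_inv]
      have := H x y
      have h3 : 0 ≤ a⁻¹ * b⁻¹ := by positivity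
      nlinarith [mul_le_mul_of_nonneg_left this h3])
  simp only [ENNReal.ofReal_mul (inv_nonneg.2 ha0.le), ENNReal.ofReal_mul (inv_nonneg.2 hb0.le),
    ENNReal.ofReal_mul (inv_nonneg.2 hc0.le)] at key
  rw [lintegral_const_mul' _ _ (by simp), lintegral_const_mul' _ _ (by simp),
    lintegral_const_mul' _ _ (by simp)] at key
  rcases eq_or_ne (∫⁻ x, ENNReal.ofReal (h x)) ∞ with hI | hI
  · simp [hI]
  have hA : (∫⁻ x, ENNReal.ofReal (f x)) ≠ ∞ := by
    intro hA
    rw [hA, ENNReal.mul_top (by simpa using ha0), top_add, top_le_iff] at key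
    exact ENNReal.mul_ne_top (by simp) (ENNReal.mul_ne_top (by simp) hI) key
  have hB : (∫⁻ x, ENNReal.ofReal (g x)) ≠ ∞ := by
    intro hB
    rw [hB, ENNReal.mul_top (by simpa using hb0), add_top, top_le_iff] at key
    exact ENNReal.mul_ne_top (by simp) (ENNReal.mul_ne_top (by simp) hI) key
  lift (∫⁻ x, ENNReal.ofReal (h x)) to NNReal using hI with C
  lift (∫⁻ x, ENNReal.ofReal (f x)) to NNReal using hA with A
  lift (∫⁻ x, ENNReal.ofReal (g x)) to NNReal using hB with B
  simp only [ENNReal.ofReal] at key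
  norm_cast at key ⊢
  rw [← NNReal.coe_le_coe] at key ⊢
  push_cast at key ⊢
  rw [Real.coe_toNNReal _ (by positivity), Real.coe_toNNReal _ (by positivity),
    Real.coe_toNNReal _ (by positivity)] at key
  have hA0 : (0 : ℝ) ≤ A := A.2
  have hB0 : (0 : ℝ) ≤ B := B.2
  have h4 : (a⁻¹ * A) * (b⁻¹ * B) ≤ (c⁻¹ * C) ^ 2 := by
    have h5 : 0 ≤ a⁻¹ * (A : ℝ) := by positivity
    have h6 : 0 ≤ b⁻¹ * (B : ℝ) := by positivity
    nlinarith [sq_nonneg (a⁻¹ * (A : ℝ) - b⁻¹ * B)]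
  rw [mul_pow, inv_pow, hc2] at h4
  have h7 : (a⁻¹ * A) * (b⁻¹ * B) = (a * b)⁻¹ * (A * B : ℝ) := by
    rw [mul_inv]; ring
  rw [h7] at h4
  exact le_of_mul_le_mul_left h4 (by positivity)

theorem prekopaLeindler_one {f g h : ℝ → ℝ≥0∞} (hf : Measurable f)
    (hg : Measurable g) (hh : Measurable h)
    (H : ∀ x y, f x * g y ≤ h ((1 / 2 : ℝ) • (x + y)) ^ 2) :
    (∫⁻ x, f x) * ∫⁻ x, g x ≤ (∫⁻ x, h x) ^ 2 := by
  have key : ∀ N : ℕ, (∫⁻ x, min (f x) N) * ∫⁻ x, min (g x) N ≤ (∫⁻ x, h x) ^ 2 := by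
    intro N
    have conv : ∀ (φ : ℝ → ℝ≥0∞) (x : ℝ),
        ENNReal.ofReal ((min (φ x) N).toReal) = min (φ x) N := fun φ x =>
      ENNReal.ofReal_toReal (by simp)
    have h1 := prekopaLeindler_real (f := fun x => (min (f x) N).toReal)
      (g := fun x => (min (g x) N).toReal) (h := fun x => (min (h x) N).toReal) (N := N)
      (by fun_prop) (by fun_prop) (by fun_prop) (fun x => by simp) (fun x => by simp)
      (fun x => by simp)
      (fun x => by
        have := ENNReal.toReal_mono (ENNReal.natCast_ne_top N) (min_le_right (f x) (N : ℝ≥0∞))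
        simpa using this)
      (fun x => by
        have := ENNReal.toReal_mono (ENNReal.natCast_ne_top N) (min_le_right (g x) (N : ℝ≥0∞))
        simpa using this)
      (fun x y => by
        rw [← ENNReal.toReal_mul, ← ENNReal.toReal_pow]
        refine ENNReal.toReal_mono (by simp) ?_
        rcases le_total (h ((1 / 2 : ℝ) • (x + y))) N with h2 | h2
        · rw [min_eq_left h2]
          exact (mul_le_mul' (min_le_left _ _) (min_le_left _ _)).trans (H x y)
        · rw [min_eq_right h2, sq]
          exact mul_le_mul' (min_le_right _ _) (min_le_right _ _))
    simp only [conv] at h1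
    exact h1.trans (pow_le_pow_left' (lintegral_mono fun x => min_le_left _ _) 2)
  have lim : ∀ φ : ℝ → ℝ≥0∞, Measurable φ →
      Filter.Tendsto (fun N : ℕ => ∫⁻ x, min (φ x) N) Filter.atTop (nhds (∫⁻ x, φ x)) := by
    intro φ hφ
    refine lintegral_tendsto_of_tendsto_of_monotone (fun N => by fun_prop)
      (Filter.Eventually.of_forall fun x i j hij => ?_) (Filter.Eventually.of_forall fun x => ?_)
    · exact min_le_min_left _ (by exact_mod_cast hij)
    · have := (tendsto_const_nhds (x := φ x)).min ENNReal.tendsto_nat_nhds_top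
      simpa using this
  rcases eq_or_ne (∫⁻ x, f x) 0 with h0 | h0
  · simp [h0]
  rcases eq_or_ne (∫⁻ x, g x) 0 with h0' | h0'
  · simp [h0']
  exact le_of_tendsto (ENNReal.Tendsto.mul (lim f hf) (Or.inl h0) (lim g hg) (Or.inl h0'))
    (Filter.Eventually.of_forall key)

/-- Prékopa–Leindler inequality for midpoints. -/
theorem prekopaLeindler (k : ℕ) {f g h : (Fin k → ℝ) → ℝ≥0∞} (hf : Measurable f)
    (hg : Measurable g) (hh : Measurable h)
    (H : ∀ x y, f x * g y ≤ h ((1 / 2 : ℝ) • (x + y)) ^ 2) :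
    (∫⁻ x, f x) * ∫⁻ x, g x ≤ (∫⁻ x, h x) ^ 2 := by
  induction k with
  | zero =>
    have e : ∀ φ : (Fin 0 → ℝ) → ℝ≥0∞, ∫⁻ x, φ x = φ 0 := fun φ => by
      have h1 : volume (Set.univ : Set (Fin 0 → ℝ)) = 1 := by simp [volume_pi]
      rw [lintegral_unique, h1, mul_one]
      exact congrArg φ (Subsingleton.elim _ _)
    rw [e, e, e]
    simpa using H 0 0
  | succ k ih =>
    have e : ∀ φ : (Fin (k + 1) → ℝ) → ℝ≥0∞, Measurable φ →
        ∫⁻ x, φ x = ∫⁻ s : ℝ, ∫⁻ y : Fin k → ℝ, φ ((MeasurableEquiv.piFinSuccAbove (fun _ : Fin (k + 1) => ℝ) 0).symm (s, y)) := by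
      intro φ hφ
      have mp := (volume_preserving_piFinSuccAbove (fun _ : Fin (k + 1) => ℝ) 0).symm
      rw [← mp.lintegral_comp hφ, Measure.volume_eq_prod, lintegral_prod _ (by fun_prop)]
    have m : ∀ φ : (Fin (k + 1) → ℝ) → ℝ≥0∞, Measurable φ →
        Measurable fun p : ℝ × (Fin k → ℝ) => φ ((MeasurableEquiv.piFinSuccAbove (fun _ : Fin (k + 1) => ℝ) 0).symm p) := by
      intro φ hφ
      exact hφ.comp (MeasurableEquiv.piFinSuccAbove (fun _ : Fin (k + 1) => ℝ) 0).symm.measurable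
    rw [e f hf, e g hg, e h hh]
    refine prekopaLeindler_one (m f hf).lintegral_prod_right' (m g hg).lintegral_prod_right'
      (m h hh).lintegral_prod_right' fun s t => ?_
    refine ih ((m f hf).comp measurable_prodMk_left) ((m g hg).comp measurable_prodMk_left)
      ((m h hh).comp measurable_prodMk_left) fun x y => ?_
    refine (H _ _).trans_eq ?_
    congr 2
    ext i
    refine Fin.cases ?_ (fun j => ?_) i <;> simp [MeasurableEquiv.piFinSuccAbove, mul_add]

section Planar

variable {k : ℕ}

/-- The points of `Q` whose planar part lies in the unit disc, in the right half-plane, with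
polar angle in `X`. -/
def angularSector (Q : Set ((ℝ × ℝ) × (Fin k → ℝ))) (X : Set ℝ) : Set ((ℝ × ℝ) × (Fin k → ℝ)) :=
  {p | p ∈ Q ∧ 0 < p.1.1 ∧ p.1.1 ^ 2 + p.1.2 ^ 2 < 1 ∧ arctan (p.1.2 / p.1.1) ∈ X}

theorem measurableSet_angularSector {Q : Set ((ℝ × ℝ) × (Fin k → ℝ))} (hQ : MeasurableSet Q)
    {X : Set ℝ} (hX : MeasurableSet X) : MeasurableSet (angularSector Q X) := by
  have h1 : MeasurableSet {p : (ℝ × ℝ) × (Fin k → ℝ) | 0 < p.1.1} :=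
    measurableSet_lt (by fun_prop) (by fun_prop)
  have h2 : MeasurableSet {p : (ℝ × ℝ) × (Fin k → ℝ) | p.1.1 ^ 2 + p.1.2 ^ 2 < 1} :=
    measurableSet_lt (by fun_prop) (by fun_prop)
  have h3 : Measurable fun p : (ℝ × ℝ) × (Fin k → ℝ) => arctan (p.1.2 / p.1.1) :=
    measurable_arctan.comp (by fun_prop)
  exact hQ.inter (h1.inter (h2.inter (h3 hX)))

theorem volume_fiber_smul {Q : Set ((ℝ × ℝ) × (Fin k → ℝ))}
    (hcone : ∀ r : ℝ, 0 < r → ∀ p ∈ Q, r • p ∈ Q) {r : ℝ} (hr : 0 < r) (a : ℝ × ℝ) :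
    volume {w | (r • a, w) ∈ Q} = ENNReal.ofReal (r ^ k) * volume {w | (a, w) ∈ Q} := by
  have h : {w | (r • a, w) ∈ Q} = (fun w => r • w) '' {w | (a, w) ∈ Q} := by
    ext w
    constructor
    · intro hw
      refine ⟨r⁻¹ • w, ?_, by simp [smul_smul, hr.ne']⟩
      have := hcone r⁻¹ (by positivity) _ hw
      simpa [smul_smul, hr.ne', Prod.smul_mk] using this
    · rintro ⟨w, hw, rfl⟩
      exact hcone r hr _ hw
  rw [h, Set.image_smul, Measure.addHaar_smul]
  simp [abs_of_pos hr]

theorem volume_fiber_mul_le {Q : Set ((ℝ × ℝ) × (Fin k → ℝ))} (hQ : MeasurableSet Q)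
    (hconv : Convex ℝ Q) (a b : ℝ × ℝ) :
    volume {w | (a, w) ∈ Q} * volume {w | (b, w) ∈ Q} ≤
      volume {w | ((1 / 2 : ℝ) • (a + b), w) ∈ Q} ^ 2 := by
  have hm : ∀ a, MeasurableSet {w | (a, w) ∈ Q} := fun a => measurable_prodMk_left hQ
  have := prekopaLeindler k (measurable_one.indicator (hm a)) (measurable_one.indicator (hm b))
    (measurable_one.indicator (hm ((1 / 2 : ℝ) • (a + b)))) (fun x y => ?_)
  · simpa [lintegral_indicator_one, hm] using this
  · by_cases hx : (a, x) ∈ Q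
    · by_cases hy : (b, y) ∈ Q
      · have : ((1 / 2 : ℝ) • (a + b), (1 / 2 : ℝ) • (x + y)) ∈ Q := by
          have := hconv hx hy (a := 1 / 2) (b := 1 / 2) (by norm_num) (by norm_num) (by norm_num)
          simpa [smul_add] using this
        simp only [Set.indicator, Set.mem_ofPred_eq, hx, hy, if_true, Pi.one_apply, mul_one]
        rw [if_pos this, one_pow]
      · simp [Set.indicator, hy]
    · simp [Set.indicator, hx]

theorem volume_angularSector {Q : Set ((ℝ × ℝ) × (Fin k → ℝ))} (hQ : MeasurableSet Q)
    (hcone : ∀ r : ℝ, 0 < r → ∀ p ∈ Q, r • p ∈ Q) {X : Set ℝ} (hX : MeasurableSet X)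
    (hXs : X ⊆ Set.Ioo (-(π / 2)) (π / 2)) :
    volume (angularSector Q X) =
      (∫⁻ r in Set.Ioo (0 : ℝ) 1, ENNReal.ofReal (r ^ (k + 1))) *
        ∫⁻ θ, X.indicator (fun θ => volume {w | ((cos θ, sin θ), w) ∈ Q}) θ := by
  have hv : Measurable fun a : ℝ × ℝ => volume {w | (a, w) ∈ Q} := measurable_measure_prodMk_left hQ
  have hS := measurableSet_angularSector hQ hX
  rw [Measure.volume_eq_prod, Measure.prod_apply hS, ← lintegral_comp_polarCoord_symm,
    polarCoord_target]
  have hJ : Measurable (X.indicator (fun θ => volume {w | ((cos θ, sin θ), w) ∈ Q})) := by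
    refine Measurable.indicator ?_ hX
    exact hv.comp (by fun_prop : Measurable fun θ : ℝ => (cos θ, sin θ))
  have e : ∀ p ∈ Set.Ioi (0 : ℝ) ×ˢ Set.Ioo (-π) π,
      ENNReal.ofReal p.1 • volume (Prod.mk (polarCoord.symm p) ⁻¹' angularSector Q X) =
      (Set.Ioo (0 : ℝ) 1).indicator (fun r => ENNReal.ofReal (r ^ (k + 1))) p.1 *
        X.indicator (fun θ => volume {w | ((cos θ, sin θ), w) ∈ Q}) p.2 := by
    rintro ⟨r, θ⟩ ⟨hr, hθ⟩
    simp only [Set.mem_Ioi] at hr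
    simp only [polarCoord_symm_apply, smul_eq_mul]
    have hn : (r * cos θ) ^ 2 + (r * sin θ) ^ 2 = r ^ 2 := by
      nlinarith [sin_sq_add_cos_sq θ]
    by_cases hθX : θ ∈ X
    · have hc := cos_pos_of_mem_Ioo (hXs hθX)
      have hat : arctan (r * sin θ / (r * cos θ)) = θ := by
        rw [mul_div_mul_left _ _ hr.ne', ← tan_eq_sin_div_cos]
        exact arctan_tan (hXs hθX).1 (hXs hθX).2
      rw [Set.indicator_of_mem hθX]
      by_cases hr1 : r < 1
      · have : Prod.mk (r * cos θ, r * sin θ) ⁻¹' angularSector Q X =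
            {w | (r • (cos θ, sin θ), w) ∈ Q} := by
          ext w
          simp only [Set.mem_preimage, angularSector, Set.mem_ofPred_eq, hat, hn]
          have : r ^ 2 < 1 := by nlinarith
          simp [hθX, this, hr, hc]
        rw [this, volume_fiber_smul hcone hr, Set.indicator_of_mem (Set.mem_Ioo.2 ⟨hr, hr1⟩),
          ← mul_assoc, ← ENNReal.ofReal_mul hr.le, pow_succ']
      · have : Prod.mk (r * cos θ, r * sin θ) ⁻¹' angularSector Q X = ∅ := by
          ext w
          simp only [Set.mem_preimage, angularSector, Set.mem_ofPred_eq, hn]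
          have : ¬ r ^ 2 < 1 := by nlinarith
          simp [this]
        rw [this]
        simp [hr1]
    · have : Prod.mk (r * cos θ, r * sin θ) ⁻¹' angularSector Q X = ∅ := by
        ext w
        simp only [Set.mem_preimage, angularSector, Set.mem_ofPred_eq, Set.mem_empty_iff_false,
          iff_false, not_and]
        intro _ hc _ hX'
        have hc' : 0 < cos θ := by
          by_contra! h
          nlinarith
        refine hθX ?_
        rw [mul_div_mul_left _ _ hr.ne', ← tan_eq_sin_div_cos] at hX'
        have hθ' : θ ∈ Set.Ioo (-(π / 2)) (π / 2) := by
          constructor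
          · by_contra! h
            have := cos_nonpos_of_pi_div_two_le_of_le (x := -θ) (by linarith) (by linarith [hθ.1, pi_pos])
            rw [cos_neg] at this
            linarith
          · by_contra! h
            have := cos_nonpos_of_pi_div_two_le_of_le (x := θ) (by linarith) (by linarith [hθ.2, pi_pos])
            linarith
        rwa [arctan_tan hθ'.1 hθ'.2] at hX'
      rw [this, Set.indicator_of_notMem hθX]
      simp
  rw [setLIntegral_congr_fun (measurableSet_Ioi.prod measurableSet_Ioo) e, Measure.volume_eq_prod,
    ← Measure.prod_restrict, lintegral_prod_mul]
  · congr 1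
    · rw [lintegral_indicator measurableSet_Ioo, Measure.restrict_restrict measurableSet_Ioo,
        Set.inter_eq_left.2 Set.Ioo_subset_Ioi_self]
    · rw [lintegral_indicator hX, lintegral_indicator hX, Measure.restrict_restrict hX,
        Set.inter_eq_left.2]
      exact hXs.trans (Set.Ioo_subset_Ioo (by linarith [pi_pos]) (by linarith [pi_pos]))
  · exact (Measurable.indicator (by fun_prop) measurableSet_Ioo).aemeasurable
  · exact hJ.aemeasurable

theorem volume_angularSector_mul_le {Q : Set ((ℝ × ℝ) × (Fin k → ℝ))} (hQ : MeasurableSet Q)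
    (hconv : Convex ℝ Q) (hcone : ∀ r : ℝ, 0 < r → ∀ p ∈ Q, r • p ∈ Q) {X Y Z : Set ℝ}
    (hX : MeasurableSet X) (hY : MeasurableSet Y) (hZ : MeasurableSet Z)
    (hXs : X ⊆ Set.Ioo (-(π / 2)) (π / 2)) (hYs : Y ⊆ Set.Ioo (-(π / 2)) (π / 2))
    (hZs : Z ⊆ Set.Ioo (-(π / 2)) (π / 2))
    (hZXY : ∀ x ∈ X, ∀ y ∈ Y, (1 / 2 : ℝ) • (x + y) ∈ Z) :
    volume (angularSector Q X) * volume (angularSector Q Y) ≤ volume (angularSector Q Z) ^ 2 := by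
  have hJ : Measurable (fun θ : ℝ => volume {w | ((cos θ, sin θ), w) ∈ Q}) := by
    have hv : Measurable fun a : ℝ × ℝ => volume {w | (a, w) ∈ Q} :=
      measurable_measure_prodMk_left hQ
    exact hv.comp (by fun_prop : Measurable fun θ : ℝ => (cos θ, sin θ))
  rw [volume_angularSector hQ hcone hX hXs, volume_angularSector hQ hcone hY hYs,
    volume_angularSector hQ hcone hZ hZs, mul_mul_mul_comm, mul_pow, ← sq]
  gcongr
  refine prekopaLeindler_one (hJ.indicator hX) (hJ.indicator hY) (hJ.indicator hZ) fun x y => ?_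
  by_cases hx : x ∈ X
  swap
  · simp [hx]
  by_cases hy : y ∈ Y
  swap
  · simp [hy]
  rw [Set.indicator_of_mem hx, Set.indicator_of_mem hy, Set.indicator_of_mem (hZXY x hx y hy)]
  refine (volume_fiber_mul_le hQ hconv _ _).trans ?_
  have h1 : (1 / 2 : ℝ) • ((cos x, sin x) + (cos y, sin y)) =
      cos ((x - y) / 2) • (cos ((1 / 2 : ℝ) • (x + y)), sin ((1 / 2 : ℝ) • (x + y))) := by
    have e1 : (1 / 2 : ℝ) • (x + y) = (x + y) / 2 := by simp; ring
    rw [e1]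
    ext
    · simp only [Prod.fst_add, Prod.smul_fst, smul_eq_mul, cos_add_cos]
      ring
    · have : sin x + sin y = 2 * sin ((x + y) / 2) * cos ((x - y) / 2) := by
        have e2 : x = (x + y) / 2 + (x - y) / 2 := by ring
        have e3 : y = (x + y) / 2 - (x - y) / 2 := by ring
        conv_lhs => rw [e2, e3]
        rw [sin_add, sin_sub]
        ring_nf
      simp only [Prod.snd_add, Prod.smul_snd, smul_eq_mul, this]
      ring
  have hc : 0 < cos ((x - y) / 2) := by
    have := hXs hx
    have := hYs hy
    simp only [Set.mem_Ioo] at *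
    exact cos_pos_of_mem_Ioo ⟨by linarith, by linarith⟩
  rw [h1, volume_fiber_smul hcone hc]
  gcongr
  refine mul_le_of_le_one_left' ?_
  rw [ENNReal.ofReal_le_one]
  exact pow_le_one₀ hc.le (cos_le_one _)

end Planar

open NormedSpace in
theorem norm_normalize_sub_normalize_mul_le {E : Type*} [NormedAddCommGroup E] [NormedSpace ℝ E]
    (a b : E) : ‖a‖ * ‖normalize a - normalize b‖ ≤ 2 * ‖a - b‖ := by
  have h1 : ‖a‖ * ‖normalize a - normalize b‖ = ‖a - ‖a‖ • normalize b‖ := by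
    conv_lhs => rw [← norm_norm a]
    rw [← norm_smul, smul_sub, norm_smul_normalize]
  have h2 : a - ‖a‖ • normalize b = (a - b) + (‖b‖ - ‖a‖) • normalize b := by
    rw [sub_smul, norm_smul_normalize]
    abel
  have h3 : ‖normalize b‖ ≤ 1 := by
    rcases eq_or_ne b 0 with rfl | hb
    · simp
    · rw [norm_normalize hb]
  rw [h1, h2]
  refine (norm_add_le _ _).trans ?_
  rw [norm_smul, Real.norm_eq_abs, two_mul]
  gcongr
  calc |‖b‖ - ‖a‖| * ‖normalize b‖ ≤ |‖b‖ - ‖a‖| * 1 := by gcongr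
    _ ≤ ‖a - b‖ := by
      rw [mul_one, abs_sub_comm]
      exact abs_norm_sub_norm_le a b

section Plane

variable {E : Type*} [NormedAddCommGroup E] [InnerProductSpace ℝ E]

theorem norm_sq_planar {e₀ e₁ : E} (h0 : ‖e₀‖ = 1) (h1 : ‖e₁‖ = 1) (h01 : ⟪e₀, e₁⟫ = 0) (x y : ℝ) :
    ‖x • e₀ + y • e₁‖ ^ 2 = x ^ 2 + y ^ 2 := by
  rw [norm_add_sq_real, norm_smul, norm_smul, inner_smul_left, inner_smul_right, h0, h1, h01]
  simp

theorem norm_cos_smul_add_sin_smul {e₀ e₁ : E} (h0 : ‖e₀‖ = 1) (h1 : ‖e₁‖ = 1)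
    (h01 : ⟪e₀, e₁⟫ = 0) (θ : ℝ) : ‖cos θ • e₀ + sin θ • e₁‖ = 1 := by
  have := norm_sq_planar h0 h1 h01 (cos θ) (sin θ)
  rw [cos_sq_add_sin_sq] at this
  exact (pow_eq_one_iff_of_nonneg (norm_nonneg _) two_ne_zero).1 this

theorem normalize_planar {e₀ e₁ : E} (h0 : ‖e₀‖ = 1) (h1 : ‖e₁‖ = 1) (h01 : ⟪e₀, e₁⟫ = 0)
    {x : ℝ} (hx : 0 < x) (y : ℝ) :
    NormedSpace.normalize (x • e₀ + y • e₁) =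
      cos (arctan (y / x)) • e₀ + sin (arctan (y / x)) • e₁ := by
  set θ := arctan (y / x) with hθ
  have hc : 0 < cos θ := cos_arctan_pos _
  have ht : y / x = sin θ / cos θ := by rw [← tan_eq_sin_div_cos, hθ, tan_arctan]
  have e : x • e₀ + y • e₁ = (x / cos θ) • (cos θ • e₀ + sin θ • e₁) := by
    rw [smul_add, smul_smul, smul_smul]
    congr 2
    · field_simp
    · field_simp at ht ⊢
      linarith
  rw [e, NormedSpace.normalize_smul_of_pos (by positivity)]
  exact NormedSpace.normalize_eq_self_of_norm_eq_one (norm_cos_smul_add_sin_smul h0 h1 h01 θ)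

theorem norm_normalize_sub_planar_le {e₀ e₁ : E} (h0 : ‖e₀‖ = 1) (h1 : ‖e₁‖ = 1)
    (h01 : ⟪e₀, e₁⟫ = 0) {ε : ℝ} {p : E} (hp : p ≠ 0) (hx : 0 < ⟪e₀, p⟫)
    (hthin : ‖p - (⟪e₀, p⟫ • e₀ + ⟪e₁, p⟫ • e₁)‖ ≤ ε * ‖p‖) :
    ‖NormedSpace.normalize p - (cos (arctan (⟪e₁, p⟫ / ⟪e₀, p⟫)) • e₀ +
      sin (arctan (⟪e₁, p⟫ / ⟪e₀, p⟫)) • e₁)‖ ≤ 2 * ε := by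
  rw [← normalize_planar h0 h1 h01 hx]
  have := norm_normalize_sub_normalize_mul_le p (⟪e₀, p⟫ • e₀ + ⟪e₁, p⟫ • e₁)
  refine le_of_mul_le_mul_left ?_ (norm_pos_iff.2 hp)
  linarith

/-- The normalized midpoint of two unit vectors close to a plane is close to the planar unit
vector at the mean angle. -/
theorem norm_normalize_add_sub_planar_le {e₀ e₁ o : E} (h0 : ‖e₀‖ = 1) (h1 : ‖e₁‖ = 1)
    (h01 : ⟪e₀, e₁⟫ = 0) (ho : ‖o‖ = 1) {c ε : ℝ} (hc : 0 < c) {p q : E} (hp : c ≤ ⟪p, o⟫)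
    (hq : c ≤ ⟪q, o⟫) {α β : ℝ} (hα : α ∈ Set.Ioo (-(π / 2)) (π / 2))
    (hβ : β ∈ Set.Ioo (-(π / 2)) (π / 2)) (hpα : ‖p - (cos α • e₀ + sin α • e₁)‖ ≤ 2 * ε)
    (hqβ : ‖q - (cos β • e₀ + sin β • e₁)‖ ≤ 2 * ε) :
    ‖NormedSpace.normalize (p + q) -
      (cos ((1 / 2 : ℝ) • (α + β)) • e₀ + sin ((1 / 2 : ℝ) • (α + β)) • e₁)‖ ≤ 4 * ε / c := by
  have e1 : (1 / 2 : ℝ) • (α + β) = (α + β) / 2 := by simp; ring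
  have hcos : 0 < cos ((α - β) / 2) := by
    simp only [Set.mem_Ioo] at hα hβ
    exact cos_pos_of_mem_Ioo ⟨by linarith, by linarith⟩
  have e2 : (cos α • e₀ + sin α • e₁) + (cos β • e₀ + sin β • e₁) =
      (2 * cos ((α - β) / 2)) • (cos ((α + β) / 2) • e₀ + sin ((α + β) / 2) • e₁) := by
    have hs : sin α + sin β = 2 * sin ((α + β) / 2) * cos ((α - β) / 2) := by
      have e2 : α = (α + β) / 2 + (α - β) / 2 := by ring
      have e3 : β = (α + β) / 2 - (α - β) / 2 := by ring
      conv_lhs => rw [e2, e3]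
      rw [sin_add, sin_sub]
      ring_nf
    have : (cos α • e₀ + sin α • e₁) + (cos β • e₀ + sin β • e₁) =
        (cos α + cos β) • e₀ + (sin α + sin β) • e₁ := by module
    rw [this, cos_add_cos, hs]
    module
  have e3 : NormedSpace.normalize ((cos α • e₀ + sin α • e₁) + (cos β • e₀ + sin β • e₁)) =
      cos ((1 / 2 : ℝ) • (α + β)) • e₀ + sin ((1 / 2 : ℝ) • (α + β)) • e₁ := by
    rw [e1, e2, NormedSpace.normalize_smul_of_pos (by positivity)]
    exact NormedSpace.normalize_eq_self_of_norm_eq_one (norm_cos_smul_add_sin_smul h0 h1 h01 _)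
  rw [← e3]
  have h2 := norm_normalize_sub_normalize_mul_le (p + q)
    ((cos α • e₀ + sin α • e₁) + (cos β • e₀ + sin β • e₁))
  have h3 : 2 * c ≤ ‖p + q‖ := by
    have := real_inner_le_norm (p + q) o
    rw [inner_add_left, ho] at this
    linarith
  have h4 : ‖p + q - ((cos α • e₀ + sin α • e₁) + (cos β • e₀ + sin β • e₁))‖ ≤ 4 * ε := by
    rw [add_sub_add_comm]
    exact (norm_add_le _ _).trans (by linarith)
  rw [le_div_iff₀ hc]
  nlinarith [mul_le_mul_of_nonneg_right h3 (norm_nonneg (NormedSpace.normalize (p + q) -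
    NormedSpace.normalize ((cos α • e₀ + sin α • e₁) + (cos β • e₀ + sin β • e₁))))]

end Plane

section Thin

variable {E : Type*} [NormedAddCommGroup E] [InnerProductSpace ℝ E]

/-- The splitting of the coordinates in an orthonormal basis into two planar ones and the rest. -/
noncomputable def planarCoord {k : ℕ} (b : OrthonormalBasis (Fin 2 ⊕ Fin k) ℝ E) (p : E) :
    (ℝ × ℝ) × (Fin k → ℝ) :=
  ((⟪b (Sum.inl 0), p⟫, ⟪b (Sum.inl 1), p⟫), fun i => ⟪b (Sum.inr i), p⟫)

theorem measurePreserving_planarCoord [FiniteDimensional ℝ E] [MeasurableSpace E] [BorelSpace E]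
    {k : ℕ} (b : OrthonormalBasis (Fin 2 ⊕ Fin k) ℝ E) :
    MeasurePreserving (planarCoord b) := by
  have h1 := b.measurePreserving_repr
  have h2 := PiLp.volume_preserving_ofLp (Fin 2 ⊕ Fin k)
  have h3 := volume_measurePreserving_sumPiEquivProdPi (fun _ : Fin 2 ⊕ Fin k => ℝ)
  have h4 := (volume_preserving_finTwoArrow ℝ).prod (MeasurePreserving.id (volume : Measure (Fin k → ℝ)))
  have h5 := h4.comp (h3.comp (h2.comp h1))
  have e : planarCoord b = Prod.map MeasurableEquiv.finTwoArrow id ∘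
      (MeasurableEquiv.sumPiEquivProdPi fun _ : Fin 2 ⊕ Fin k => ℝ) ∘ WithLp.ofLp ∘ b.repr := by
    ext p <;> simp [planarCoord, MeasurableEquiv.sumPiEquivProdPi, Equiv.sumPiEquivProdPi,
      OrthonormalBasis.repr_apply_apply]
  rw [e]
  exact h5

theorem exists_planarCoord_eq {k : ℕ} (b : OrthonormalBasis (Fin 2 ⊕ Fin k) ℝ E) :
    ∃ F : ((ℝ × ℝ) × (Fin k → ℝ)) →ₗ[ℝ] E, Continuous F ∧ (∀ p, F (planarCoord b p) = p) := by
  refine ⟨{ toFun := fun p => p.1.1 • b (Sum.inl 0) + p.1.2 • b (Sum.inl 1) +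
              ∑ i, p.2 i • b (Sum.inr i), map_add' := ?_, map_smul' := ?_ }, ?_, ?_⟩
  · intro p q
    simp only [Prod.fst_add, Prod.snd_add, Pi.add_apply, add_smul, Finset.sum_add_distrib]
    abel
  · intro r p
    simp [smul_add, smul_smul, Finset.smul_sum]
  · simp only [LinearMap.coe_mk, AddHom.coe_mk]
    fun_prop
  · intro p
    conv_rhs => rw [← b.sum_repr p]
    simp [planarCoord, Fintype.sum_sum_type, OrthonormalBasis.repr_apply_apply]

open NormedSpace Metric in
/-- Spherical midpoint inequality inside a thin cone around a half-plane. -/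
theorem thin_cone_inequality [FiniteDimensional ℝ E] [MeasurableSpace E] [BorelSpace E]
    {k : ℕ} (b : OrthonormalBasis (Fin 2 ⊕ Fin k) ℝ E) {Q A A' M : Set E} (hQ : IsClosed Q)
    (hconv : Convex ℝ Q) (hcone : ∀ r : ℝ, 0 < r → ∀ p ∈ Q, r • p ∈ Q)
    (hA : IsCompact A) (hA' : IsCompact A') (hA1 : A ⊆ sphere 0 1) (hA1' : A' ⊆ sphere 0 1)
    {o : E} (ho : ‖o‖ = 1) {c ε δ : ℝ} (hc : 0 < c) (hεc : ε < c) (hε1 : ε < 1)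
    (hδ : 2 * ε + 4 * ε / c ≤ δ) (hcA : ∀ z ∈ A, c ≤ ⟪z, o⟫) (hcA' : ∀ z ∈ A', c ≤ ⟪z, o⟫)
    (hM : ∀ z ∈ A, ∀ z' ∈ A', normalize (z + z') ∈ M)
    (hthin : ∀ p ∈ Q, ‖p - (⟪b (Sum.inl 0), p⟫ • b (Sum.inl 0) +
      ⟪b (Sum.inl 1), p⟫ • b (Sum.inl 1))‖ ≤ ε * ‖p‖)
    (ho1 : ⟪b (Sum.inl 1), o⟫ = 0) (ho0 : 0 ≤ ⟪b (Sum.inl 0), o⟫)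
    (heq : volume (ball 0 1 ∩ (Q ∩ normalize ⁻¹' A)) =
      volume (ball 0 1 ∩ (Q ∩ normalize ⁻¹' A'))) :
    ENNReal.ofReal ((1 - ε) ^ (k + 2)) * volume (ball 0 1 ∩ (Q ∩ normalize ⁻¹' A)) ≤
      volume (ball 0 1 ∩ (Q ∩ normalize ⁻¹' (cthickening δ M))) := by
  obtain ⟨F, hFc, hF⟩ := exists_planarCoord_eq b
  set e₀ := b (Sum.inl 0) with he₀
  set e₁ := b (Sum.inl 1) with he₁
  have h0 : ‖e₀‖ = 1 := b.norm_eq_one _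
  have h1 : ‖e₁‖ = 1 := b.norm_eq_one _
  have h01 : ⟪e₀, e₁⟫ = 0 := b.inner_eq_zero (by simp)
  have mp := measurePreserving_planarCoord b
  set Q' : Set ((ℝ × ℝ) × (Fin k → ℝ)) := F ⁻¹' Q with hQ'
  have hQ'c : IsClosed Q' := hQ.preimage hFc
  have hQ'conv : Convex ℝ Q' := hconv.linear_preimage F
  have hQ'cone : ∀ r : ℝ, 0 < r → ∀ p ∈ Q', r • p ∈ Q' := by
    intro r hr p hp
    simp only [hQ', Set.mem_preimage, map_smul] at hp ⊢
    exact hcone r hr _ hp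
  have hmem : ∀ (X : Set ℝ) (p : E), p ∈ planarCoord b ⁻¹' angularSector Q' X ↔
      p ∈ Q ∧ 0 < ⟪e₀, p⟫ ∧ ⟪e₀, p⟫ ^ 2 + ⟪e₁, p⟫ ^ 2 < 1 ∧ arctan (⟪e₁, p⟫ / ⟪e₀, p⟫) ∈ X := by
    intro X p
    simp only [Set.mem_preimage, angularSector, Set.mem_ofPred_eq, hQ', hF]
    rfl
  have hpos : ∀ z, z ∈ Q → ‖z‖ = 1 → c ≤ ⟪z, o⟫ → 0 < ⟪e₀, z⟫ := by
    intro z hz hz1 hzc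
    have e : ⟪z, o⟫ = ⟪e₀, z⟫ * ⟪e₀, o⟫ + ⟪z - (⟪e₀, z⟫ • e₀ + ⟪e₁, z⟫ • e₁), o⟫ := by
      rw [inner_sub_left, inner_add_left, inner_smul_left, inner_smul_left, ho1]
      simp
    have h2 := real_inner_le_norm (z - (⟪e₀, z⟫ • e₀ + ⟪e₁, z⟫ • e₁)) o
    have h3 := hthin z hz
    rw [hz1] at h3
    rw [ho] at h2
    by_contra! h
    nlinarith
  set α : E → ℝ := fun p => arctan (⟪e₁, p⟫ / ⟪e₀, p⟫) with hα
  have hαmem : ∀ p, α p ∈ Set.Ioo (-(π / 2)) (π / 2) := fun p => arctan_mem_Ioo _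
  have hang : ∀ B : Set E, IsCompact B → B ⊆ sphere 0 1 → (∀ z ∈ B, c ≤ ⟪z, o⟫) →
      IsCompact (α '' (B ∩ Q)) ∧ volume (ball 0 1 ∩ (Q ∩ normalize ⁻¹' B)) ≤
        volume (angularSector Q' (α '' (B ∩ Q))) := by
    intro B hB hB1 hBc
    have hcpt : IsCompact (α '' (B ∩ Q)) := by
      refine (hB.inter_right hQ).image_of_continuousOn ?_
      refine continuous_arctan.comp_continuousOn (ContinuousOn.div (by fun_prop) (by fun_prop) ?_)
      rintro z ⟨hz, hzQ⟩
      exact (hpos z hzQ (by simpa using hB1 hz) (hBc z hz)).ne'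
    refine ⟨hcpt, ?_⟩
    rw [← mp.measure_preimage
      (measurableSet_angularSector hQ'c.measurableSet hcpt.measurableSet).nullMeasurableSet]
    refine measure_mono ?_
    rintro p ⟨hp1, hpQ, hpB⟩
    rw [hmem]
    have hp0 : p ≠ 0 := by
      rintro rfl
      have := hB1 hpB
      simp at this
    have hpn := norm_pos_iff.2 hp0
    have hNQ : normalize p ∈ Q := hcone _ (inv_pos.2 hpn) p hpQ
    have hx : 0 < ⟪e₀, normalize p⟫ := hpos _ hNQ (norm_normalize hp0) (hBc _ hpB)
    have hx' : ⟪e₀, normalize p⟫ = ‖p‖⁻¹ * ⟪e₀, p⟫ := by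
      rw [NormedSpace.normalize, inner_smul_right]
    have hy' : ⟪e₁, normalize p⟫ = ‖p‖⁻¹ * ⟪e₁, p⟫ := by
      rw [NormedSpace.normalize, inner_smul_right]
    refine ⟨hpQ, ?_, ?_, normalize p, ⟨hpB, hNQ⟩, ?_⟩
    · rw [hx'] at hx
      exact (pos_iff_pos_of_mul_pos hx).1 (inv_pos.2 hpn)
    · have h4 := b.sum_sq_inner_right p
      rw [Fintype.sum_sum_type, Fin.sum_univ_two] at h4
      have h5 : 0 ≤ ∑ i, ⟪b (Sum.inr i), p⟫ ^ 2 := Finset.sum_nonneg fun i _ => sq_nonneg _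
      have h6 : ‖p‖ < 1 := by simpa using hp1
      nlinarith
    · simp only [hα, hx', hy']
      rw [mul_div_mul_left _ _ (inv_pos.2 hpn).ne']
  obtain ⟨hI, hIle⟩ := hang A hA hA1 hcA
  obtain ⟨hI', hIle'⟩ := hang A' hA' hA1' hcA'
  set I := α '' (A ∩ Q)
  set I' := α '' (A' ∩ Q)
  set Z := (fun p : ℝ × ℝ => (1 / 2 : ℝ) • (p.1 + p.2)) '' (I ×ˢ I')
  have hIs : I ⊆ Set.Ioo (-(π / 2)) (π / 2) := by
    rintro _ ⟨p, -, rfl⟩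
    exact hαmem p
  have hIs' : I' ⊆ Set.Ioo (-(π / 2)) (π / 2) := by
    rintro _ ⟨p, -, rfl⟩
    exact hαmem p
  have hZ : IsCompact Z := (hI.prod hI').image (by fun_prop)
  have hZs : Z ⊆ Set.Ioo (-(π / 2)) (π / 2) := by
    rintro _ ⟨⟨x, y⟩, ⟨hx, hy⟩, rfl⟩
    have := hIs hx
    have := hIs' hy
    simp only [Set.mem_Ioo, smul_eq_mul] at *
    constructor <;> linarith
  have key := volume_angularSector_mul_le hQ'c.measurableSet hQ'conv hQ'cone hI.measurableSet
    hI'.measurableSet hZ.measurableSet hIs hIs' hZs (fun x hx y hy => ⟨(x, y), ⟨hx, hy⟩, rfl⟩)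
  have h7 : volume (ball 0 1 ∩ (Q ∩ normalize ⁻¹' A)) ≤ volume (angularSector Q' Z) := by
    rw [← ENNReal.pow_le_pow_left_iff two_ne_zero, sq]
    refine le_trans ?_ key
    nth_rewrite 2 [heq]
    gcongr
  refine (mul_le_mul_right h7 _).trans ?_
  rw [← mp.measure_preimage
    (measurableSet_angularSector hQ'c.measurableSet hZ.measurableSet).nullMeasurableSet]
  have hdim : Module.finrank ℝ E = k + 2 := by
    rw [Module.finrank_eq_card_basis b.toBasis]
    simp [add_comm]
  have hs : ENNReal.ofReal ((1 - ε) ^ (k + 2)) * volume (planarCoord b ⁻¹' angularSector Q' Z) =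
      volume ((fun p => (1 - ε) • p) '' (planarCoord b ⁻¹' angularSector Q' Z)) := by
    rw [Set.image_smul, Measure.addHaar_smul, hdim, abs_of_nonneg]
    exact pow_nonneg (by linarith) _
  rw [hs]
  refine measure_mono ?_
  rintro _ ⟨p, hp, rfl⟩
  have hε' : 0 < 1 - ε := by linarith
  rw [hmem] at hp
  obtain ⟨hpQ, hx, hxy, ⟨θ, θ'⟩, ⟨⟨z, ⟨hzA, hzQ⟩, hzθ⟩, ⟨z', ⟨hzA', hzQ'⟩, hzθ'⟩⟩, hpθ⟩ := hp
  simp only at hpθ hzθ hzθ'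
  have hp0 : p ≠ 0 := by
    rintro rfl
    simp at hx
  have hz1 : ‖z‖ = 1 := by simpa using hA1 hzA
  have hz1' : ‖z'‖ = 1 := by simpa using hA1' hzA'
  have hd : ∀ q : E, ‖q‖ = 1 → q ∈ Q → 0 < ⟪e₀, q⟫ →
      ‖q - (cos (α q) • e₀ + sin (α q) • e₁)‖ ≤ 2 * ε := by
    intro q hq1 hqQ hq
    have := norm_normalize_sub_planar_le h0 h1 h01 (norm_pos_iff.1 (by rw [hq1]; exact one_pos)) hq
      (hthin q hqQ)
    rwa [normalize_eq_self_of_norm_eq_one hq1] at this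
  refine ⟨?_, hcone _ hε' p hpQ, ?_⟩
  · rw [mem_ball_zero_iff, norm_smul, Real.norm_eq_abs, abs_of_pos hε']
    have h8 := hthin p hpQ
    have h9 : ‖⟪e₀, p⟫ • e₀ + ⟪e₁, p⟫ • e₁‖ < 1 := by
      rw [← sq_lt_one_iff₀ (norm_nonneg _), norm_sq_planar h0 h1 h01]
      exact hxy
    have h10 := norm_sub_norm_le p (⟪e₀, p⟫ • e₀ + ⟪e₁, p⟫ • e₁)
    linarith
  · rw [Set.mem_preimage, normalize_smul_of_pos hε']
    refine mem_cthickening_of_dist_le _ _ δ M (hM z hzA z' hzA') ?_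
    have h8 := norm_normalize_sub_planar_le h0 h1 h01 hp0 hx (hthin p hpQ)
    rw [← hpθ] at h8
    have h9 := norm_normalize_add_sub_planar_le h0 h1 h01 ho hc (hcA z hzA) (hcA' z' hzA')
      (hαmem z) (hαmem z') (hd z hz1 hzQ (hpos z hzQ hz1 (hcA z hzA)))
      (hd z' hz1' hzQ' (hpos z' hzQ' hz1' (hcA' z' hzA')))
    rw [hzθ, hzθ'] at h9
    refine le_trans ?_ hδ
    rw [dist_eq_norm]
    refine (norm_sub_le_norm_sub_add_norm_sub _ _ _).trans (add_le_add h8 ?_)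
    rwa [norm_sub_rev]

end Thin

section Bisection

variable {E : Type*} [NormedAddCommGroup E] [InnerProductSpace ℝ E]

/-- The closed half-space with inner normal `n`. -/
def halfSpace (n : E) : Set E := {p | 0 ≤ ⟪n, p⟫}

theorem isClosed_halfSpace (n : E) : IsClosed (halfSpace n) :=
  isClosed_le continuous_const (by fun_prop)

theorem convex_halfSpace (n : E) : Convex ℝ (halfSpace n) := by
  intro x hx y hy a b ha hb _
  simp only [halfSpace, Set.mem_ofPred_eq, inner_add_right, inner_smul_right] at *
  positivity

variable [FiniteDimensional ℝ E] [MeasurableSpace E] [BorelSpace E]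

theorem volume_inner_eq_zero {n : E} (hn : n ≠ 0) : volume {p : E | ⟪n, p⟫ = 0} = 0 := by
  have h := Measure.addHaar_submodule (volume : Measure E) (LinearMap.ker (innerSL ℝ n).toLinearMap)
    (fun h => hn ?_)
  · convert h using 2
    ext p
    simp
  · rw [LinearMap.ker_eq_top] at h
    have := LinearMap.congr_fun h n
    simpa using this

theorem integral_halfSpace_add_neg {μ : Measure E} (hμ : μ ≪ volume) {g : E → ℝ}
    (hg : Integrable g μ) {n : E} (hn : n ≠ 0) :
    (∫ p in halfSpace n, g p ∂μ) + ∫ p in halfSpace (-n), g p ∂μ = ∫ p, g p ∂μ := by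
  have h : (halfSpace (-n) : Set E) =ᵐ[μ] (halfSpace n)ᶜ := by
    have h0 : ∀ᵐ p ∂μ, ⟪n, p⟫ ≠ 0 := hμ.ae_le (measure_eq_zero_iff_ae_notMem.1 (volume_inner_eq_zero hn))
    filter_upwards [h0] with p hp
    apply propext
    change p ∈ halfSpace (-n) ↔ p ∈ (halfSpace n)ᶜ
    simp only [halfSpace, Set.mem_ofPred_eq, inner_neg_left, Set.mem_compl_iff, not_le]
    constructor
    · intro h
      exact lt_of_le_of_ne (by linarith) hp
    · intro h
      linarith
  rw [setIntegral_congr_set h]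
  exact integral_add_compl (isClosed_halfSpace n).measurableSet hg

theorem continuous_integral_halfSpace {μ : Measure E} (hμ : μ ≪ volume) {g : E → ℝ}
    (hg : Integrable g μ) {n : ℝ → E} (hn : Continuous n) (hn0 : ∀ θ, n θ ≠ 0) :
    Continuous fun θ => ∫ p in halfSpace (n θ), g p ∂μ := by
  have e : ∀ θ, ∫ p in halfSpace (n θ), g p ∂μ = ∫ p, (halfSpace (n θ)).indicator g p ∂μ :=
    fun θ => (integral_indicator (isClosed_halfSpace _).measurableSet).symm
  simp only [e]
  rw [continuous_iff_continuousAt]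
  intro θ
  refine continuousAt_of_dominated (bound := fun p => ‖g p‖) ?_ ?_ hg.norm ?_
  · exact Filter.Eventually.of_forall fun θ =>
      hg.aestronglyMeasurable.indicator (isClosed_halfSpace _).measurableSet
  · exact Filter.Eventually.of_forall fun θ => Filter.Eventually.of_forall fun p =>
      norm_indicator_le_norm_self _ _
  · have h0 : ∀ᵐ p ∂μ, ⟪n θ, p⟫ ≠ 0 :=
      hμ.ae_le (measure_eq_zero_iff_ae_notMem.1 (volume_inner_eq_zero (hn0 θ)))
    filter_upwards [h0] with p hp
    have hc : Continuous fun θ => ⟪n θ, p⟫ := by fun_prop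
    rcases lt_or_gt_of_ne hp with h | h
    · refine ContinuousAt.congr (f := fun _ => (0 : ℝ)) continuousAt_const ?_
      filter_upwards [hc.continuousAt.eventually_lt continuousAt_const h] with t ht
      simp [halfSpace, ht]
    · refine ContinuousAt.congr (f := fun _ => g p) continuousAt_const ?_
      filter_upwards [continuousAt_const.eventually_lt hc.continuousAt h] with t ht
      simp [halfSpace, ht.le]

/-- Bisection by a half-space whose normal lies in the span of two given vectors. -/
theorem exists_halfSpace_bisection {μ : Measure E} (hμ : μ ≪ volume) {g₁ g₂ : E → ℝ}
    (hg₁ : Integrable g₁ μ) (hg₂ : Integrable g₂ μ) (h1 : ∫ p, g₁ p ∂μ = 0)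
    (h2 : 0 < ∫ p, g₂ p ∂μ) (v w : E) :
    ∃ z : Circle, (∫ p in halfSpace ((z : ℂ).re • v + (z : ℂ).im • w), g₁ p ∂μ) = 0 ∧
      0 < ∫ p in halfSpace ((z : ℂ).re • v + (z : ℂ).im • w), g₂ p ∂μ := by
  by_cases hz : ∃ z : Circle, (z : ℂ).re • v + (z : ℂ).im • w = 0
  · obtain ⟨z, hz⟩ := hz
    refine ⟨z, ?_⟩
    have : halfSpace (0 : E) = Set.univ := by
      ext
      simp [halfSpace]
    simpa [hz, this] using ⟨h1, h2⟩
  push Not at hz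
  set n : ℝ → E := fun θ => cos θ • v + sin θ • w with hn
  have hzn : ∀ θ, ((Circle.exp θ : Circle) : ℂ).re • v + ((Circle.exp θ : Circle) : ℂ).im • w = n θ := by
    intro θ
    rw [Circle.coe_exp, Complex.exp_ofReal_mul_I_re, Complex.exp_ofReal_mul_I_im]
  have hn0 : ∀ θ, n θ ≠ 0 := fun θ => by
    rw [← hzn]
    exact hz _
  have hnπ : ∀ θ, n (θ + π) = - n θ := fun θ => by
    simp only [hn, cos_add_pi, sin_add_pi]
    module
  have hadd : ∀ g : E → ℝ, Integrable g μ → ∀ θ, (∫ p in halfSpace (n θ), g p ∂μ) +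
      ∫ p in halfSpace (n (θ + π)), g p ∂μ = ∫ p, g p ∂μ := fun g hg θ => by
    rw [hnπ]
    exact integral_halfSpace_add_neg hμ hg (hn0 θ)
  have hcont := continuous_integral_halfSpace hμ hg₁ (by fun_prop : Continuous n) hn0
  have h0 := hadd g₁ hg₁ 0
  rw [h1, zero_add] at h0
  obtain ⟨θ, hθ⟩ : ∃ θ, ∫ p in halfSpace (n θ), g₁ p ∂μ = 0 := by
    rcases le_total 0 (∫ p in halfSpace (n 0), g₁ p ∂μ) with h | h
    · exact mem_range_of_exists_le_of_exists_ge hcont ⟨π, by linarith⟩ ⟨0, h⟩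
    · exact mem_range_of_exists_le_of_exists_ge hcont ⟨0, h⟩ ⟨π, by linarith⟩
  have h3 := hadd g₁ hg₁ θ
  have h4 := hadd g₂ hg₂ θ
  by_cases h5 : 0 < ∫ p in halfSpace (n θ), g₂ p ∂μ
  · refine ⟨Circle.exp θ, ?_⟩
    rw [hzn]
    exact ⟨hθ, h5⟩
  · refine ⟨Circle.exp (θ + π), ?_⟩
    rw [hzn]
    constructor <;> linarith

/-- Closed convex cones on which `g₁` has zero and `g₂` has positive integral. -/
structure IsBalancedCone (μ : Measure E) (g₁ g₂ : E → ℝ) (Q : Set E) : Prop where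
  isClosed : IsClosed Q
  convex : Convex ℝ Q
  smul_mem : ∀ r : ℝ, 0 < r → ∀ p ∈ Q, r • p ∈ Q
  integral_eq_zero : ∫ p in Q, g₁ p ∂μ = 0
  integral_pos : 0 < ∫ p in Q, g₂ p ∂μ

theorem IsBalancedCone.exists_inter_halfSpace {μ : Measure E} (hμ : μ ≪ volume) {g₁ g₂ : E → ℝ}
    (hg₁ : Integrable g₁ μ) (hg₂ : Integrable g₂ μ) {Q : Set E} (hQ : IsBalancedCone μ g₁ g₂ Q)
    (v w : E) : ∃ z : Circle,
      IsBalancedCone μ g₁ g₂ (halfSpace ((z : ℂ).re • v + (z : ℂ).im • w) ∩ Q) := by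
  obtain ⟨z, h1, h2⟩ := exists_halfSpace_bisection (μ := μ.restrict Q)
    (Measure.absolutelyContinuous_of_le Measure.restrict_le_self |>.trans hμ) hg₁.restrict
    hg₂.restrict hQ.integral_eq_zero hQ.integral_pos v w
  refine ⟨z, (isClosed_halfSpace _).inter hQ.isClosed, (convex_halfSpace _).inter hQ.convex, ?_, ?_, ?_⟩
  · rintro r hr p ⟨hp, hpQ⟩
    refine ⟨?_, hQ.smul_mem r hr p hpQ⟩
    simp only [halfSpace, Set.mem_ofPred_eq, inner_smul_right] at hp ⊢
    positivity
  · rwa [Measure.restrict_restrict (isClosed_halfSpace _).measurableSet] at h1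
  · rwa [Measure.restrict_restrict (isClosed_halfSpace _).measurableSet] at h2

/-- A needle sequence: repeated bisection yields a decreasing sequence of balanced cones whose
intersection is contained in some half-space with normal in each two-dimensional pencil. -/
theorem exists_antitone_isBalancedCone {μ : Measure E} (hμ : μ ≪ volume) {g₁ g₂ : E → ℝ}
    (hg₁ : Integrable g₁ μ) (hg₂ : Integrable g₂ μ) (h1 : ∫ p, g₁ p ∂μ = 0)
    (h2 : 0 < ∫ p, g₂ p ∂μ) :
    ∃ Q : ℕ → Set E, Antitone Q ∧ (∀ i, IsBalancedCone μ g₁ g₂ (Q i)) ∧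
      ∀ v w : E, ∃ z : Circle, ∀ p ∈ ⋂ i, Q i, 0 ≤ ⟪(z : ℂ).re • v + (z : ℂ).im • w, p⟫ := by
  classical
  have step := fun (Q : {Q : Set E // IsBalancedCone μ g₁ g₂ Q}) (vw : E × E) =>
    Q.2.exists_inter_halfSpace hμ hg₁ hg₂ vw.1 vw.2
  choose z hz using step
  let d : ℕ → E × E := TopologicalSpace.denseSeq (E × E)
  let Q : ℕ → {Q : Set E // IsBalancedCone μ g₁ g₂ Q} := fun i => Nat.rec
    ⟨Set.univ, isClosed_univ, convex_univ, fun _ _ _ _ => trivial, by simpa using h1, by simpa using h2⟩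
    (fun i Q => ⟨_, hz Q (d i)⟩) i
  have hQs : ∀ i, (Q (i + 1)).1 = halfSpace ((z (Q i) (d i) : ℂ).re • (d i).1 +
      (z (Q i) (d i) : ℂ).im • (d i).2) ∩ (Q i).1 := fun i => rfl
  refine ⟨fun i => (Q i).1, antitone_nat_of_succ_le fun i => ?_, fun i => (Q i).2, ?_⟩
  · rw [hQs]
    exact Set.inter_subset_right
  · set S : Set E := ⋂ i, (Q i).1
    set C : Set (Circle × (E × E)) :=
      {x | ∀ p ∈ S, 0 ≤ ⟪(x.1 : ℂ).re • x.2.1 + (x.1 : ℂ).im • x.2.2, p⟫} with hC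
    have hCc : IsClosed C := by
      have : C = ⋂ p ∈ S, {x : Circle × (E × E) |
          0 ≤ ⟪(x.1 : ℂ).re • x.2.1 + (x.1 : ℂ).im • x.2.2, p⟫} := by
        ext
        simp [hC]
      rw [this]
      refine isClosed_biInter fun p _ => isClosed_le continuous_const ?_
      have : Continuous fun x : Circle × (E × E) => (x.1 : ℂ) := by fun_prop
      have h1 := Complex.continuous_re.comp this
      have h2 := Complex.continuous_im.comp this
      exact Continuous.inner ((h1.smul (by fun_prop)).add (h2.smul (by fun_prop))) continuous_const
    have hW : IsClosed (Prod.snd '' C) := isClosedMap_snd_of_compactSpace _ hCc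
    have hd : Set.range d ⊆ Prod.snd '' C := by
      rintro _ ⟨i, rfl⟩
      refine ⟨(z (Q i) (d i), d i), fun p hp => ?_, rfl⟩
      have : p ∈ (Q (i + 1)).1 := Set.mem_iInter.1 hp (i + 1)
      rw [hQs] at this
      exact this.1
    intro v w
    have : (v, w) ∈ Prod.snd '' C :=
      hW.closure_subset_iff.2 hd (TopologicalSpace.denseRange_denseSeq (E × E) (v, w))
    obtain ⟨⟨z, x⟩, hz, rfl⟩ := this
    exact ⟨z, hz⟩

end Bisection

section Needle

variable {E : Type*} [NormedAddCommGroup E] [InnerProductSpace ℝ E] [FiniteDimensional ℝ E]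

theorem LinearIndependent.exists_inner_eq {ι : Type*} {p : ι → E} (hp : LinearIndependent ℝ p)
    (c : ι → ℝ) : ∃ v : E, ∀ i, ⟪v, p i⟫ = c i := by
  obtain ⟨f, hf⟩ : ∃ f : E →ₗ[ℝ] ℝ, ∀ i, f (p i) = c i := by
    obtain ⟨f, hf⟩ := LinearMap.exists_extend ((Module.Basis.span hp).constr ℝ c)
    refine ⟨f, fun i => ?_⟩
    have h1 := LinearMap.congr_fun hf (Module.Basis.span hp i)
    rw [Module.Basis.constr_basis] at h1
    rw [← h1]
    simp [Module.Basis.span_apply]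
  refine ⟨(InnerProductSpace.toDual ℝ E).symm (LinearMap.toContinuousLinearMap f), fun i => ?_⟩
  rw [InnerProductSpace.toDual_symm_apply]
  exact hf i

theorem finrank_span_le_two {S : Set E}
    (hS : ∀ v w : E, ∃ z : Circle, ∀ p ∈ S, 0 ≤ ⟪(z : ℂ).re • v + (z : ℂ).im • w, p⟫) :
    Module.finrank ℝ (Submodule.span ℝ S) ≤ 2 := by
  by_contra! h
  obtain ⟨f, hfS, -, hf⟩ := Submodule.exists_fun_fin_finrank_span_eq ℝ S
  have h3 : LinearIndependent ℝ (f ∘ Fin.castLE (Nat.succ_le_of_lt h)) :=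
    hf.comp _ (Fin.castLE_injective _)
  obtain ⟨v, hv⟩ := h3.exists_inner_eq ![1, 0, -1]
  obtain ⟨w, hw⟩ := h3.exists_inner_eq ![0, 1, -1]
  obtain ⟨z, hz⟩ := hS v w
  have hz' : ∀ i, 0 ≤ (z : ℂ).re * (![1, 0, -1] : Fin 3 → ℝ) i +
      (z : ℂ).im * (![0, 1, -1] : Fin 3 → ℝ) i := by
    intro i
    have := hz _ (hfS (Fin.castLE (Nat.succ_le_of_lt h) i))
    rw [inner_add_left, inner_smul_left, inner_smul_left] at this
    rw [← hv, ← hw]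
    simpa using this
  have a0 := hz' 0
  have a1 := hz' 1
  have a2 := hz' 2
  simp at a0 a1 a2
  have hn := Circle.normSq_coe z
  rw [Complex.normSq_apply] at hn
  have : (z : ℂ).re = 0 := by linarith
  have h' : (z : ℂ).im = 0 := by linarith
  rw [this, h'] at hn
  norm_num at hn

theorem exists_norm_eq_one_of_finrank_lt {s : Submodule ℝ E}
    (hs : Module.finrank ℝ s < Module.finrank ℝ E) : ∃ e : E, ‖e‖ = 1 ∧ ∀ p ∈ s, ⟪p, e⟫ = 0 := by
  have h1 := s.finrank_add_finrank_orthogonal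
  have h2 : sᗮ ≠ ⊥ := by
    intro h
    rw [h, finrank_bot] at h1
    omega
  obtain ⟨e, he, he0⟩ := Submodule.exists_mem_ne_zero_of_ne_bot h2
  refine ⟨NormedSpace.normalize e, NormedSpace.norm_normalize he0, fun p hp => ?_⟩
  rw [NormedSpace.normalize, inner_smul_right, (Submodule.mem_orthogonal s e).1 he p hp, mul_zero]

/-- An orthonormal basis adapted to a subspace of dimension at most two and a direction `o`. -/
theorem exists_adapted_orthonormalBasis {k : ℕ} (hE : Module.finrank ℝ E = k + 2)
    (W : Submodule ℝ E) (hW : Module.finrank ℝ W ≤ 2) (o : E) :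
    ∃ b : OrthonormalBasis (Fin 2 ⊕ Fin k) ℝ E, (∀ p ∈ W, ∀ i, ⟪b (Sum.inr i), p⟫ = 0) ∧
      ⟪b (Sum.inl 1), o⟫ = 0 ∧ 0 ≤ ⟪b (Sum.inl 0), o⟫ := by
  have h1 := W.finrank_add_finrank_orthogonal
  have hk : k ≤ Module.finrank ℝ Wᗮ := by omega
  set f : Fin k → E := fun i => (stdOrthonormalBasis ℝ Wᗮ (Fin.castLE hk i) : E) with hf
  have hfo : Orthonormal ℝ f := by
    have := (stdOrthonormalBasis ℝ Wᗮ).orthonormal.comp_linearIsometry Wᗮ.subtypeₗᵢ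
    exact this.comp _ (Fin.castLE_injective hk)
  have hfr : ∀ x : E, Module.finrank ℝ (Submodule.span ℝ (Set.range f ∪ {x})) <
      Module.finrank ℝ E := by
    intro x
    rw [Submodule.span_union]
    have := Submodule.finrank_add_le_finrank_add_finrank (Submodule.span ℝ (Set.range f))
      (Submodule.span ℝ {x})
    have h2 := finrank_range_le_card (R := ℝ) f
    have h3 := finrank_span_le_card (R := ℝ) ({x} : Set E)
    rw [Set.toFinset_card, Set.card_singleton] at h3
    rw [Set.finrank] at h2
    simp only [Fintype.card_fin] at h2
    omega
  obtain ⟨e₁, he₁, ho₁⟩ := exists_norm_eq_one_of_finrank_lt (hfr o)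
  obtain ⟨e₀', he₀', ho₀'⟩ := exists_norm_eq_one_of_finrank_lt (hfr e₁)
  obtain ⟨e₀, he₀, ho₀, hpos⟩ : ∃ e : E, ‖e‖ = 1 ∧
      (∀ p ∈ Submodule.span ℝ (Set.range f ∪ {e₁}), ⟪p, e⟫ = 0) ∧ 0 ≤ ⟪e, o⟫ := by
    rcases le_total 0 ⟪e₀', o⟫ with h | h
    · exact ⟨e₀', he₀', ho₀', h⟩
    · refine ⟨-e₀', by simpa using he₀', fun p hp => ?_, by simpa using h⟩
      rw [inner_neg_right, ho₀' p hp, neg_zero]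
  have hf1 : ∀ i, ⟪f i, e₁⟫ = 0 := fun i => ho₁ _ (Submodule.subset_span (Or.inl ⟨i, rfl⟩))
  have hf0 : ∀ i, ⟪f i, e₀⟫ = 0 := fun i => ho₀ _ (Submodule.subset_span (Or.inl ⟨i, rfl⟩))
  have h10 : ⟪e₁, e₀⟫ = 0 := ho₀ _ (Submodule.subset_span (Or.inr rfl))
  have h1o : ⟪o, e₁⟫ = 0 := ho₁ _ (Submodule.subset_span (Or.inr rfl))
  have hon : Orthonormal ℝ (Sum.elim ![e₀, e₁] f) := by
    constructor
    · rintro (i | i)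
      · fin_cases i <;> simp [he₀, he₁]
      · exact hfo.1 i
    · rintro (i | i) (j | j) hij
      · fin_cases i <;> fin_cases j <;> simp at hij ⊢
        · rw [real_inner_comm]; exact h10
        · exact h10
      · fin_cases i <;> simp
        · rw [real_inner_comm]; exact hf0 j
        · rw [real_inner_comm]; exact hf1 j
      · fin_cases j <;> simp
        · exact hf0 i
        · exact hf1 i
      · exact hfo.2 (fun h => hij (by rw [h]))
  have hcard : Module.finrank ℝ E = Fintype.card (Fin 2 ⊕ Fin k) := by
    simp [hE, add_comm]
  obtain ⟨b, hb⟩ := Orthonormal.exists_orthonormalBasis_extension_of_card_eq (s := Set.univ) hcard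
    (v := Sum.elim ![e₀, e₁] f) (by
      exact hon.comp _ Subtype.val_injective)
  refine ⟨b, fun p hp i => ?_, ?_, ?_⟩
  · rw [hb _ (Set.mem_univ _), Sum.elim_inr, real_inner_comm]
    exact (Submodule.mem_orthogonal W _).1 (stdOrthonormalBasis ℝ Wᗮ (Fin.castLE hk i)).2 p hp
  · rw [hb _ (Set.mem_univ _), real_inner_comm]
    simpa using h1o
  · rw [hb _ (Set.mem_univ _)]
    simpa using hpos

theorem exists_thin {k : ℕ} (b : OrthonormalBasis (Fin 2 ⊕ Fin k) ℝ E) {Q : ℕ → Set E}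
    (hQ : Antitone Q) (hQc : ∀ i, IsClosed (Q i)) (hcone : ∀ i, ∀ r : ℝ, 0 < r → ∀ p ∈ Q i, r • p ∈ Q i)
    (hb : ∀ p ∈ ⋂ i, Q i, ∀ i, ⟪b (Sum.inr i), p⟫ = 0) {ε : ℝ} (hε : 0 < ε) :
    ∃ i, ∀ p ∈ Q i, ‖p - (⟪b (Sum.inl 0), p⟫ • b (Sum.inl 0) +
      ⟪b (Sum.inl 1), p⟫ • b (Sum.inl 1))‖ ≤ ε * ‖p‖ := by
  set D : E → E := fun p => p - (⟪b (Sum.inl 0), p⟫ • b (Sum.inl 0) +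
      ⟪b (Sum.inl 1), p⟫ • b (Sum.inl 1)) with hD
  have hDc : Continuous D := by fun_prop
  have hDs : ∀ (r : ℝ) p, D (r • p) = r • D p := by
    intro r p
    simp only [hD, inner_smul_right]
    module
  set C : Set E := Metric.sphere 0 1 ∩ {p | ε ≤ ‖D p‖} with hC
  have hCcl : IsClosed {p | ε ≤ ‖D p‖} := isClosed_le continuous_const (by fun_prop)
  have hCc : IsCompact C := (isCompact_sphere 0 1).inter_right hCcl
  have hempty : C ∩ ⋂ i, Q i = ∅ := by
    ext p
    simp only [Set.mem_inter_iff, Set.mem_empty_iff_false, iff_false, not_and]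
    rintro ⟨hp, hpε⟩ hpQ
    have : D p = 0 := by
      rw [hD]
      simp only
      conv_lhs => enter [1]; rw [← b.sum_repr p]
      simp [Fintype.sum_sum_type, OrthonormalBasis.repr_apply_apply, hb p hpQ]
    simp only [Set.mem_ofPred_eq, this, norm_zero] at hpε
    linarith
  obtain ⟨i, hi⟩ := hCc.elim_directed_family_closed Q hQc hempty
    (directed_of_isDirected_le fun i j hij => hQ hij)
  refine ⟨i, fun p hp => ?_⟩
  rcases eq_or_ne p 0 with rfl | hp0
  · simp
  have hpn := norm_pos_iff.2 hp0
  by_contra! h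
  have hmem : ‖p‖⁻¹ • p ∈ C ∩ Q i := by
    refine ⟨⟨?_, ?_⟩, hcone i _ (inv_pos.2 hpn) p hp⟩
    · simp [norm_smul, hp0]
    · simp only [Set.mem_ofPred_eq, hDs, norm_smul, norm_inv, norm_norm]
      rw [le_inv_mul_iff₀ hpn]
      linarith
  rw [hi] at hmem
  exact hmem

end Needle

open Metric in
/-- Spherical Brunn–Minkowski inequality for midpoints, in terms of cone measure. -/
theorem spherical_midpoint_inequality {E : Type*} [NormedAddCommGroup E] [InnerProductSpace ℝ E]
    [FiniteDimensional ℝ E] [MeasurableSpace E] [BorelSpace E] (hE : 2 ≤ Module.finrank ℝ E)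
    {A A' M : Set E} (hA : IsCompact A) (hA' : IsCompact A') (hA1 : A ⊆ sphere 0 1)
    (hA1' : A' ⊆ sphere 0 1) (hMc : IsClosed M) {o : E} (ho : ‖o‖ = 1) {c : ℝ} (hc : 0 < c)
    (hcA : ∀ z ∈ A, c ≤ ⟪z, o⟫) (hcA' : ∀ z ∈ A', c ≤ ⟪z, o⟫)
    (hM : ∀ z ∈ A, ∀ z' ∈ A', NormedSpace.normalize (z + z') ∈ M)
    (heq : volume (ball (0 : E) 1 ∩ NormedSpace.normalize ⁻¹' A) = volume (ball (0 : E) 1 ∩ NormedSpace.normalize ⁻¹' A')) :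
    volume (ball (0 : E) 1 ∩ NormedSpace.normalize ⁻¹' A) ≤ volume (ball (0 : E) 1 ∩ NormedSpace.normalize ⁻¹' M) := by
  by_contra! hlt
  obtain ⟨k, hk⟩ : ∃ k, Module.finrank ℝ E = k + 2 := ⟨_, (Nat.sub_add_cancel hE).symm⟩
  set μ : Measure E := volume.restrict (ball (0 : E) 1) with hμ
  have : IsFiniteMeasure μ := ⟨by simp [hμ, measure_ball_lt_top]⟩
  have hN : Measurable (NormedSpace.normalize : E → E) := by
    unfold NormedSpace.normalize
    fun_prop
  have hμ' : ∀ B : Set E, volume (ball (0 : E) 1 ∩ B) = μ B := fun B => by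
    rw [hμ, Measure.restrict_apply' measurableSet_ball, Set.inter_comm]
  have hμr : ∀ B : Set E, (volume (ball (0 : E) 1 ∩ B)).toReal = μ.real B := fun B => by
    rw [hμ', Measure.real]
  obtain ⟨δ, hδ0, hδ⟩ : ∃ δ > 0, μ (NormedSpace.normalize ⁻¹' (cthickening δ M)) < μ (NormedSpace.normalize ⁻¹' A) := by
    have ht := tendsto_measure_cthickening_of_isClosed (μ := μ.map NormedSpace.normalize) (s := M)
      ⟨1, one_pos, measure_ne_top _ _⟩ hMc
    have hlt' : (μ.map NormedSpace.normalize) M < μ (NormedSpace.normalize ⁻¹' A) := by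
      rw [Measure.map_apply hN hMc.measurableSet, ← hμ', ← hμ']
      exact hlt
    have hev := (ht.mono_left (nhdsWithin_le_nhds (s := Set.Ioi 0))).eventually_lt_const hlt'
    obtain ⟨δ, h1, h2⟩ := (hev.and self_mem_nhdsWithin).exists
    rw [Measure.map_apply hN isClosed_cthickening.measurableSet] at h1
    exact ⟨δ, h2, h1⟩
  set Â := (NormedSpace.normalize ⁻¹' A : Set E) with hÂ
  set Â' := (NormedSpace.normalize ⁻¹' A' : Set E) with hÂ'
  set B := (NormedSpace.normalize ⁻¹' (cthickening δ M) : Set E) with hB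
  have mA : MeasurableSet Â := hN hA.measurableSet
  have mA' : MeasurableSet Â' := hN hA'.measurableSet
  have mB : MeasurableSet B := hN isClosed_cthickening.measurableSet
  have hδr : μ.real B < μ.real Â := (ENNReal.toReal_lt_toReal (by simp) (by simp)).2 hδ
  obtain ⟨ε₀, hε₀, hε₀'⟩ : ∃ ε₀ > 0, 0 < μ.real Â - μ.real B - ε₀ * μ.real Set.univ := by
    refine ⟨(μ.real Â - μ.real B) / (2 * (μ.real Set.univ + 1)), ?_, ?_⟩
    · have : 0 ≤ μ.real Set.univ := measureReal_nonneg
      have : 0 < μ.real Â - μ.real B := by linarith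
      positivity
    · have : 0 ≤ μ.real Set.univ := measureReal_nonneg
      have h1 : 0 < μ.real Â - μ.real B := by linarith
      rw [sub_pos, div_mul_eq_mul_div, div_lt_iff₀ (by positivity)]
      nlinarith
  set g₁ : E → ℝ := fun p => Â.indicator 1 p - Â'.indicator 1 p with hg₁
  set g₂ : E → ℝ := fun p => Â.indicator 1 p - B.indicator 1 p - ε₀ with hg₂
  have iind : ∀ {S : Set E}, MeasurableSet S → ∀ (Q : Set E),
      Integrable (S.indicator (1 : E → ℝ)) (μ.restrict Q) := fun hS Q =>
    (integrable_const (1 : ℝ)).indicator hS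
  have int₁ : ∀ Q : Set E, ∫ p in Q, g₁ p ∂μ = μ.real (Q ∩ Â) - μ.real (Q ∩ Â') := by
    intro Q
    rw [hg₁, integral_sub (iind mA Q) (iind mA' Q), integral_indicator_one mA,
      integral_indicator_one mA', measureReal_restrict_apply mA, measureReal_restrict_apply mA',
      Set.inter_comm, Set.inter_comm Â']
  have int₂ : ∀ Q : Set E, ∫ p in Q, g₂ p ∂μ =
      μ.real (Q ∩ Â) - μ.real (Q ∩ B) - ε₀ * μ.real Q := by
    intro Q
    have e1 : ∫ p in Q, g₂ p ∂μ = (∫ p in Q, (Â.indicator 1 p - B.indicator 1 p) ∂μ) -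
        ∫ _ in Q, ε₀ ∂μ := integral_sub ((iind mA Q).sub (iind mB Q)) (integrable_const _)
    rw [e1, integral_sub (iind mA Q) (iind mB Q), integral_indicator_one mA,
      integral_indicator_one mB, measureReal_restrict_apply mA, measureReal_restrict_apply mB,
      Set.inter_comm, Set.inter_comm B]
    simp [mul_comm]
  have hi₁ : Integrable g₁ μ := by
    have := (iind mA Set.univ).sub (iind mA' Set.univ)
    rwa [Measure.restrict_univ] at this
  have hi₂ : Integrable g₂ μ := by
    have := ((iind mA Set.univ).sub (iind mB Set.univ)).sub (integrable_const ε₀)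
    rwa [Measure.restrict_univ] at this
  obtain ⟨Q, hQa, hQb, hQ⟩ := exists_antitone_isBalancedCone (μ := μ)
    Measure.restrict_le_self.absolutelyContinuous hi₁ hi₂ (by
      rw [← Measure.restrict_univ (μ := μ), int₁]
      simp only [Set.univ_inter]
      rw [← hμr, ← hμr, heq, sub_self]) (by
      rw [← Measure.restrict_univ (μ := μ), int₂]
      simpa using hε₀')
  obtain ⟨b, hb, hb1, hb0⟩ := exists_adapted_orthonormalBasis hk
    (Submodule.span ℝ (⋂ i, Q i)) (finrank_span_le_two hQ) o
  obtain ⟨ε, hε, hε0⟩ : ∃ ε : ℝ, ((ε < c ∧ ε < 1) ∧ (2 * ε + 4 * ε / c < δ ∧ 1 - (1 - ε) ^ (k + 2) < ε₀)) ∧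
      0 < ε := by
    have ev : ∀ (f : ℝ → ℝ) (l : ℝ), Continuous f → f 0 = 0 → 0 < l →
        ∀ᶠ ε in nhdsWithin (0 : ℝ) (Set.Ioi 0), f ε < l := by
      intro f l hf h0 hl
      refine (hf.continuousAt.eventually_lt continuousAt_const ?_).filter_mono nhdsWithin_le_nhds
      rwa [h0]
    exact (((ev (fun ε => ε) c (by fun_prop) rfl hc).and (ev (fun ε => ε) 1 (by fun_prop) rfl one_pos)).and
      ((ev (fun ε => 2 * ε + 4 * ε / c) δ (by fun_prop) (by simp) hδ0).and
      (ev (fun ε => 1 - (1 - ε) ^ (k + 2)) ε₀ (by fun_prop) (by simp) hε₀)) |>.and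
      self_mem_nhdsWithin).exists
  obtain ⟨⟨hεc, hε1⟩, hεδ, hεε₀⟩ := hε
  obtain ⟨i, hi⟩ := exists_thin b hQa (fun i => (hQb i).isClosed) (fun i => (hQb i).smul_mem)
    (fun p hp => hb p (Submodule.subset_span hp)) hε0
  have e1 := (hQb i).integral_eq_zero
  have e2 := (hQb i).integral_pos
  rw [int₁] at e1
  rw [int₂] at e2
  have thin := thin_cone_inequality b (hQb i).isClosed (hQb i).convex (hQb i).smul_mem hA hA' hA1
    hA1' ho hc hεc hε1 hεδ.le hcA hcA' hM hi hb1 hb0 (by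
      rw [hμ', hμ', ← ENNReal.toReal_eq_toReal_iff' (by simp) (by simp)]
      simp only [Measure.real] at e1
      linarith)
  rw [hμ', hμ'] at thin
  have hε' : 0 ≤ (1 - ε) ^ (k + 2) := pow_nonneg (by linarith) _
  have thin' := ENNReal.toReal_mono (by simp) thin
  rw [ENNReal.toReal_mul, ENNReal.toReal_ofReal hε'] at thin'
  change (1 - ε) ^ (k + 2) * μ.real (Q i ∩ Â) ≤ μ.real (Q i ∩ B) at thin'
  have hq : μ.real (Q i ∩ Â) ≤ μ.real (Q i) := measureReal_mono Set.inter_subset_left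
  have ha : 0 ≤ μ.real (Q i ∩ Â) := measureReal_nonneg
  nlinarith

section UniformMeasure

open Metric Filter Topology

/-- Two finite measures on `S` which give equal mass to balls of equal radius centred in `S` are
proportional. -/
theorem MeasureTheory.Measure.exists_eq_smul_of_closedBall {X : Type*} [MetricSpace X]
    [SecondCountableTopology X] [MeasurableSpace X] [BorelSpace X] [HasBesicovitchCovering X]
    {σ κ : Measure X} [IsFiniteMeasure σ] [IsFiniteMeasure κ] {S : Set X} (hσS : σ Sᶜ = 0)
    (hκS : κ Sᶜ = 0) (hσ : ∀ z ∈ S, ∀ z' ∈ S, ∀ r, σ (closedBall z r) = σ (closedBall z' r))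
    (hκ : ∀ z ∈ S, ∀ z' ∈ S, ∀ r, κ (closedBall z r) = κ (closedBall z' r)) (hκ0 : κ ≠ 0) :
    ∃ c : ℝ≥0∞, σ = c • κ := by
  rcases eq_or_ne σ 0 with rfl | hσ0
  · exact ⟨0, by simp⟩
  have key : ∀ {ρ τ : Measure X} [IsFiniteMeasure ρ] [IsFiniteMeasure τ], τ Sᶜ = 0 →
      (∀ z ∈ S, ∀ z' ∈ S, ∀ r, ρ (closedBall z r) = ρ (closedBall z' r)) →
      (∀ z ∈ S, ∀ z' ∈ S, ∀ r, τ (closedBall z r) = τ (closedBall z' r)) → τ ≠ 0 → ∀ z₀ ∈ S,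
      ∃ c : ℝ≥0∞, Tendsto (fun r => ρ (closedBall z₀ r) / τ (closedBall z₀ r)) (𝓝[>] 0) (𝓝 c) ∧
        c • τ ≤ ρ := by
    intro ρ τ _ _ hτS hρ hτ hτ0 z₀ hz₀
    have hae : ∀ᵐ z ∂τ, z ∈ S := by rw [ae_iff]; exact hτS
    have hlim : ∀ᵐ z ∂τ, Tendsto (fun r => ρ (closedBall z₀ r) / τ (closedBall z₀ r)) (𝓝[>] 0)
        (𝓝 (ρ.rnDeriv τ z)) := by
      filter_upwards [hae, Besicovitch.ae_tendsto_rnDeriv ρ τ] with z hz h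
      simpa only [hρ z hz z₀ hz₀, hτ z hz z₀ hz₀] using h
    have : NeZero τ := ⟨hτ0⟩
    obtain ⟨z₁, hz₁⟩ := hlim.exists
    refine ⟨_, hz₁, ?_⟩
    have hc : ρ.rnDeriv τ =ᵐ[τ] fun _ => ρ.rnDeriv τ z₁ := by
      filter_upwards [hlim] with z hz
      exact tendsto_nhds_unique hz hz₁
    rw [← withDensity_const, ← withDensity_congr_ae hc]
    exact Measure.withDensity_rnDeriv_le _ _
  obtain ⟨z₀, hz₀⟩ : S.Nonempty := by
    by_contra! h
    rw [h, Set.compl_empty, Measure.measure_univ_eq_zero] at hκS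
    exact hκ0 hκS
  obtain ⟨c, hc, hcle⟩ := key hκS hσ hκ hκ0 z₀ hz₀
  obtain ⟨c', hc', hcle'⟩ := key hσS hκ hσ hσ0 z₀ hz₀
  have hpos : ∀ r > 0, κ (closedBall z₀ r) ≠ 0 := by
    intro r hr h0
    refine hκ0 (Measure.measure_univ_eq_zero.1 (le_antisymm ?_ zero_le))
    rw [← Set.union_compl_self S]
    refine (measure_union_le _ _).trans ?_
    rw [hκS, add_zero, nonpos_iff_eq_zero]
    exact measure_null_of_locally_null _ fun x hx =>
      ⟨_, mem_nhdsWithin_of_mem_nhds (closedBall_mem_nhds x hr), (hκ x hx z₀ hz₀ r).trans h0⟩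
  have hinv : c' = c⁻¹ := by
    refine tendsto_nhds_unique hc' (Tendsto.congr' ?_ ((continuous_inv.tendsto c).comp hc))
    filter_upwards [self_mem_nhdsWithin] with r hr
    exact ENNReal.inv_div (Or.inl (measure_ne_top _ _)) (Or.inl (hpos r hr))
  have hc0 : c ≠ 0 := by
    rintro rfl
    rw [ENNReal.inv_zero] at hinv
    subst hinv
    have h1 := hcle' Set.univ
    rw [Measure.smul_apply, smul_eq_mul, ENNReal.top_mul (by simpa using hσ0)] at h1
    exact (measure_lt_top κ _).not_ge h1
  have hct : c ≠ ∞ := by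
    rintro rfl
    have h1 := hcle Set.univ
    rw [Measure.smul_apply, smul_eq_mul, ENNReal.top_mul (by simpa using hκ0)] at h1
    exact (measure_lt_top σ _).not_ge h1
  refine ⟨c, le_antisymm (fun A => ?_) hcle⟩
  have h1 := hcle' A
  rw [hinv, Measure.smul_apply, smul_eq_mul] at h1
  rw [Measure.smul_apply, smul_eq_mul]
  calc σ A = c * (c⁻¹ * σ A) := by rw [← mul_assoc, ENNReal.mul_inv_cancel hc0 hct, one_mul]
    _ ≤ c * κ A := by gcongr

theorem LinearIsometryEquiv.normalize_map {E : Type*} [NormedAddCommGroup E]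
    [InnerProductSpace ℝ E] (R : E ≃ₗᵢ[ℝ] E) (p : E) :
    NormedSpace.normalize (R p) = R (NormedSpace.normalize p) := by
  simp [NormedSpace.normalize]

variable {E : Type*} [NormedAddCommGroup E] [InnerProductSpace ℝ E] [FiniteDimensional ℝ E]
  [MeasurableSpace E] [BorelSpace E]

open Module in
theorem hausdorffMeasure_sphere_lt_top {m : ℕ} (hm : finrank ℝ E = m + 1) :
    μH[m] (sphere (0 : E) 1) < ∞ := by
  refine (isCompact_sphere (0 : E) 1).measure_lt_top_of_nhdsWithin fun x hx => ?_
  have hx1 : ‖x‖ = 1 := by simpa using hx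
  have hfin : finrank ℝ (ℝ ∙ x)ᗮ = m := by
    have : Fact (finrank ℝ E = m + 1) := ⟨hm⟩
    exact Submodule.finrank_orthogonal_span_singleton (norm_ne_zero_iff.1 (by simp [hx1]))
  have hinner : ∀ w : (ℝ ∙ x)ᗮ, ⟪x, (w : E)⟫ = 0 := fun w =>
    Submodule.mem_orthogonal_singleton_iff_inner_right.1 w.2
  set f : (ℝ ∙ x)ᗮ → E := fun w => NormedSpace.normalize (x + w) with hf
  have hLip : LipschitzWith 2 f := by
    refine LipschitzWith.of_dist_le_mul fun v w => ?_
    have h1 := norm_normalize_sub_normalize_mul_le (x + (v : E)) (x + w)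
    have h2 : 1 ≤ ‖x + (v : E)‖ := by
      have := norm_add_sq_real x (v : E)
      rw [hinner, hx1] at this
      nlinarith [sq_nonneg ‖(v : E)‖, norm_nonneg (x + (v : E))]
    rw [dist_eq_norm, dist_eq_norm]
    simp only [hf, add_sub_add_left_eq_sub] at h1 ⊢
    have h3 : ‖(v : E) - w‖ = ‖v - w‖ := rfl
    rw [h3] at h1
    refine le_trans ?_ h1
    exact le_mul_of_one_le_left (norm_nonneg _) h2
  have hnhds : {y : E | 1 / 2 < ⟪y, x⟫} ∈ 𝓝 x := by
    refine (isOpen_lt continuous_const (by fun_prop)).mem_nhds ?_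
    simp only [Set.mem_ofPred_eq, real_inner_self_eq_norm_sq, hx1]
    norm_num
  refine ⟨_, inter_mem_nhdsWithin _ hnhds, ?_⟩
  have hsub : sphere 0 1 ∩ {y : E | 1 / 2 < ⟪y, x⟫} ⊆ f '' closedBall 0 3 := by
    rintro y ⟨hy, hyx⟩
    have hy1 : ‖y‖ = 1 := by simpa using hy
    simp only [Set.mem_ofPred_eq] at hyx
    have hpos : 0 < ⟪y, x⟫ := by linarith
    have hmem : ⟪y, x⟫⁻¹ • y - x ∈ (ℝ ∙ x)ᗮ := by
      rw [Submodule.mem_orthogonal_singleton_iff_inner_left, inner_sub_left, inner_smul_left,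
        real_inner_self_eq_norm_sq, hx1]
      simp [hpos.ne']
    refine ⟨⟨_, hmem⟩, ?_, ?_⟩
    · rw [mem_closedBall_zero_iff]
      change ‖⟪y, x⟫⁻¹ • y - x‖ ≤ 3
      refine (norm_sub_le _ _).trans ?_
      rw [norm_smul, hy1, hx1, mul_one, norm_inv, Real.norm_eq_abs, abs_of_pos hpos]
      have : ⟪y, x⟫⁻¹ ≤ (1 / 2 : ℝ)⁻¹ := by gcongr
      norm_num at this
      linarith
    · simp only [hf, add_sub_cancel]
      rw [NormedSpace.normalize_smul_of_pos (inv_pos.2 hpos),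
        NormedSpace.normalize_eq_self_of_norm_eq_one hy1]
  refine (measure_mono hsub).trans_lt
    ((hLip.hausdorffMeasure_image_le (Nat.cast_nonneg m) _).trans_lt ?_)
  refine ENNReal.mul_lt_top (by simp) ?_
  rw [← hfin]
  exact (isCompact_closedBall _ _).measure_lt_top

theorem NormedSpace.measurable_normalize :
    Measurable (NormedSpace.normalize : E → E) := by
  unfold NormedSpace.normalize
  fun_prop

theorem LinearIsometryEquiv.volume_normalize_preimage (R : E ≃ₗᵢ[ℝ] E) (A : Set E) :
    volume (ball (0 : E) 1 ∩ NormedSpace.normalize ⁻¹' (R ⁻¹' A)) =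
      volume (ball (0 : E) 1 ∩ NormedSpace.normalize ⁻¹' A) := by
  rw [← MeasurePreserving.measure_preimage_equiv (f := R.toMeasurableEquiv) R.measurePreserving
    (ball (0 : E) 1 ∩ NormedSpace.normalize ⁻¹' A)]
  congr 1
  ext p
  simp [R.normalize_map]

open Module in
/-- On the unit sphere, Hausdorff measure is a multiple of cone measure. -/
theorem exists_hausdorffMeasure_eq_mul {m : ℕ} (hm : finrank ℝ E = m + 1) :
    ∃ c : ℝ≥0∞, ∀ A ⊆ sphere (0 : E) 1, MeasurableSet A →
      μH[m] A = c * volume (ball (0 : E) 1 ∩ NormedSpace.normalize ⁻¹' A) := by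
  have : Nontrivial E := Module.nontrivial_of_finrank_pos (R := ℝ) (by omega)
  set σ : Measure E := (μH[m] : Measure E).restrict (sphere 0 1) with hσ
  set κ : Measure E := (volume.restrict (ball (0 : E) 1)).map NormedSpace.normalize with hκ
  have hκa : ∀ A : Set E, MeasurableSet A →
      κ A = volume (ball (0 : E) 1 ∩ NormedSpace.normalize ⁻¹' A) := fun A hA => by
    rw [hκ, Measure.map_apply NormedSpace.measurable_normalize hA,
      Measure.restrict_apply' measurableSet_ball, Set.inter_comm]
  have : IsFiniteMeasure σ := ⟨by simpa [hσ] using hausdorffMeasure_sphere_lt_top hm⟩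
  have : IsFiniteMeasure κ := ⟨by simpa [hκa _ .univ] using measure_ball_lt_top⟩
  have hS : MeasurableSet (sphere (0 : E) 1) := isClosed_sphere.measurableSet
  obtain ⟨c, hc⟩ := Measure.exists_eq_smul_of_closedBall (σ := σ) (κ := κ) (S := sphere 0 1)
    (by rw [hσ, Measure.restrict_apply hS.compl]; simp) (by
      rw [hκa _ hS.compl]
      refine measure_mono_null ?_ (measure_singleton (0 : E))
      rintro p ⟨-, hp⟩
      by_contra hp0
      exact hp (by simpa using NormedSpace.norm_normalize hp0))
    (fun z hz z' hz' r => by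
      have hR := Submodule.reflection_sub (v := z) (w := z') (by simp_all)
      set R := (ℝ ∙ (z - z'))ᗮ.reflection
      rw [hσ, Measure.restrict_apply measurableSet_closedBall,
        Measure.restrict_apply measurableSet_closedBall,
        ← R.isometry.hausdorffMeasure_image (Or.inl (Nat.cast_nonneg m)),
        Set.image_inter R.injective, R.image_closedBall, R.image_sphere, hR, map_zero])
    (fun z hz z' hz' r => by
      have hR := Submodule.reflection_sub (v := z) (w := z') (by simp_all)
      set R := (ℝ ∙ (z - z'))ᗮ.reflection
      rw [hκa _ measurableSet_closedBall, hκa _ measurableSet_closedBall,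
        ← R.volume_normalize_preimage (closedBall z' r), R.preimage_closedBall, ← hR,
        R.symm_apply_apply])
    (by
      rw [← Measure.measure_univ_ne_zero, hκa _ .univ]
      simpa using (measure_ball_pos volume (0 : E) one_pos).ne')
  refine ⟨c, fun A hA1 hA => ?_⟩
  rw [← hκa A hA, ← smul_eq_mul, ← Measure.smul_apply, ← hc, hσ, Measure.restrict_apply hA,
    Set.inter_eq_left.2 hA1]

end UniformMeasure

section ConeOver

open Metric Filter Topology

variable {F G : Type*} [NormedAddCommGroup F] [InnerProductSpace ℝ F] [NormedAddCommGroup G]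
  [NormedSpace ℝ G]

/-- The cone in `{y | 0 < ⟪y, o⟫}` whose gnomonic trace, read through the coordinate `P`, is `K`. -/
def coneOver (o : F) (P : F →L[ℝ] G) (K : Set G) : Set F :=
  {y | 0 < ⟪y, o⟫ ∧ ⟪y, o⟫⁻¹ • P y ∈ K}

variable {o : F} {P : F →L[ℝ] G} {K : Set G}

theorem coneOver_smul_mem {r : ℝ} (hr : 0 < r) {y : F} (hy : y ∈ coneOver o P K) :
    r • y ∈ coneOver o P K := by
  refine ⟨?_, ?_⟩
  · rw [real_inner_smul_left]
    exact mul_pos hr hy.1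
  · rw [real_inner_smul_left, map_smul, smul_smul, mul_inv, mul_comm, mul_inv_cancel_left₀ hr.ne']
    exact hy.2

theorem coneOver_smul_mem_iff {r : ℝ} (hr : 0 < r) {y : F} :
    r • y ∈ coneOver o P K ↔ y ∈ coneOver o P K := by
  refine ⟨fun h => ?_, coneOver_smul_mem hr⟩
  simpa [smul_smul, inv_mul_cancel₀ hr.ne'] using coneOver_smul_mem (inv_pos.2 hr) h

theorem coneOver_add_mem (hK : Convex ℝ K) {y z : F} (hy : y ∈ coneOver o P K)
    (hz : z ∈ coneOver o P K) : y + z ∈ coneOver o P K := by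
  have h1 := hy.1
  have h2 := hz.1
  have h3 : 0 < ⟪y, o⟫ + ⟪z, o⟫ := add_pos h1 h2
  refine ⟨by rwa [inner_add_left], ?_⟩
  have := hK hy.2 hz.2 (a := ⟪y, o⟫ / (⟪y, o⟫ + ⟪z, o⟫)) (b := ⟪z, o⟫ / (⟪y, o⟫ + ⟪z, o⟫))
    (by positivity) (by positivity) (by field_simp)
  convert this using 1
  rw [inner_add_left, map_add, smul_add, smul_smul, smul_smul]
  congr 2 <;> field_simp

theorem coneOver_reflect_mem (ho : ‖o‖ = 1) (hPo : P o = 0) (hK : ∀ x ∈ K, -x ∈ K) {y : F}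
    (hy : y ∈ coneOver o P K) : (2 * ⟪y, o⟫) • o - y ∈ coneOver o P K := by
  have h : ⟪(2 * ⟪y, o⟫) • o - y, o⟫ = ⟪y, o⟫ := by
    rw [inner_sub_left, real_inner_smul_left, real_inner_self_eq_norm_sq, ho]
    ring
  refine ⟨by rw [h]; exact hy.1, ?_⟩
  rw [h, map_sub, map_smul, hPo, smul_zero, zero_sub, smul_neg]
  exact hK _ hy.2

theorem norm_le_of_mem_coneOver (hP : ∀ y, ‖y‖ ^ 2 = ‖P y‖ ^ 2 + ⟪y, o⟫ ^ 2) {B : ℝ}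
    (hB : ∀ x ∈ K, ‖x‖ ≤ B) {y : F} (hy : y ∈ coneOver o P K) :
    ‖y‖ ≤ √(1 + B ^ 2) * ⟪y, o⟫ := by
  have h1 := hy.1
  have h2 := hB _ hy.2
  rw [norm_smul, norm_inv, Real.norm_eq_abs, abs_of_pos h1, inv_mul_le_iff₀ h1] at h2
  refine le_of_sq_le_sq ?_ (by positivity)
  rw [mul_pow, Real.sq_sqrt (by positivity), hP]
  nlinarith [norm_nonneg (P y)]

variable {U : Submodule ℝ F}

theorem convex_coneOver_preimage (hK : Convex ℝ K) :
    Convex ℝ {p : U | (p : F) ∈ coneOver o P K} := by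
  intro p hp q hq a b ha hb hab
  rcases ha.eq_or_lt with rfl | ha
  · rw [zero_add] at hab
    simpa [hab] using hq
  rcases hb.eq_or_lt with rfl | hb
  · rw [add_zero] at hab
    simpa [hab] using hp
  exact coneOver_add_mem hK (coneOver_smul_mem ha hp) (coneOver_smul_mem hb hq)

theorem mem_closure_of_mem_coneOver_closure (ho : ‖o‖ = 1) (hPo : P o = 0) (hoU : o ∈ U)
    (hK : Convex ℝ K) (hK0 : 0 ∈ interior K) {p : U} (hp : (p : F) ∈ coneOver o P (closure K)) :
    p ∈ closure {p : U | (p : F) ∈ coneOver o P K} := by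
  set o' : U := ⟨o, hoU⟩
  have hlim : Tendsto (fun l : ℝ => p + l • o') (𝓝[>] 0) (𝓝 p) := by
    have : Tendsto (fun l : ℝ => p + l • o') (𝓝 0) (𝓝 (p + (0 : ℝ) • o')) :=
      Continuous.tendsto (by fun_prop) 0
    rw [zero_smul, add_zero] at this
    exact this.mono_left nhdsWithin_le_nhds
  refine mem_closure_of_tendsto hlim ?_
  filter_upwards [self_mem_nhdsWithin] with l hl
  have hl : 0 < l := hl
  have h1 := hp.1
  have h2 : ⟪(p : F) + l • o, o⟫ = ⟪(p : F), o⟫ + l := by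
    rw [inner_add_left, real_inner_smul_left, real_inner_self_eq_norm_sq, ho]
    ring
  refine ⟨?_, interior_subset ?_⟩
  · change 0 < ⟪(p : F) + l • o, o⟫
    rw [h2]
    linarith
  · change ⟪(p : F) + l • o, o⟫⁻¹ • P ((p : F) + l • o) ∈ interior K
    have := hK.combo_closure_interior_mem_interior hp.2 hK0
      (a := ⟪(p : F), o⟫ / (⟪(p : F), o⟫ + l)) (b := l / (⟪(p : F), o⟫ + l))
      (by positivity) (by positivity) (by field_simp)
    convert this using 1
    rw [h2, map_add, map_smul, hPo, smul_zero, smul_zero, add_zero, add_zero, smul_smul]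
    congr 1
    field_simp

theorem smul_mem_interior_coneOver_preimage {p : U}
    (hp : p ∈ interior {p : U | (p : F) ∈ coneOver o P K}) {r : ℝ} (hr : 0 < r) :
    r • p ∈ interior {p : U | (p : F) ∈ coneOver o P K} := by
  have h := (isOpen_interior (s := {p : U | (p : F) ∈ coneOver o P K})).preimage
    (continuous_const_smul r⁻¹)
  refine interior_maximal (fun q hq => ?_) h (by simpa [smul_smul, inv_mul_cancel₀ hr.ne'] using hp)
  have := interior_subset (s := {p : U | (p : F) ∈ coneOver o P K}) hq
  exact (coneOver_smul_mem_iff (inv_pos.2 hr)).1 this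

theorem isClosed_coneOver_ge (hK : IsClosed K) {c : ℝ} (hc : 0 < c) :
    IsClosed {y : F | c ≤ ⟪y, o⟫ ∧ y ∈ coneOver o P K} := by
  have hs : IsClosed {y : F | c ≤ ⟪y, o⟫} := isClosed_le continuous_const (by fun_prop)
  have hf : ContinuousOn (fun y : F => ⟪y, o⟫⁻¹ • P y) {y : F | c ≤ ⟪y, o⟫} := by
    refine ContinuousOn.smul (ContinuousOn.inv₀ (by fun_prop) fun y hy => ?_) (by fun_prop)
    exact (hc.trans_le hy).ne'
  convert hf.preimage_isClosed_of_isClosed hs hK using 1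
  ext y
  exact ⟨fun h => ⟨h.1, h.2.2⟩, fun h => ⟨h.1, hc.trans_le h.1, h.2⟩⟩

end ConeOver

section Slice

open Metric Filter Topology

variable {F G : Type*} [NormedAddCommGroup F] [InnerProductSpace ℝ F] [NormedAddCommGroup G]
  [NormedSpace ℝ G]

/-- The section of a cone by the affine hyperplane at height `s` in direction `u`, projected
radially to the unit sphere of `uᗮ`. -/
def coneSlice (o : F) (P : F →L[ℝ] G) (K : Set G) (u : F) (s : ℝ) : Set (ℝ ∙ u)ᗮ :=
  {z | ‖z‖ = 1 ∧ (z : F) + s • u ∈ coneOver o P K}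

variable {o u : F} {P : F →L[ℝ] G} {K : Set G}

theorem inner_orthogonal_singleton (z : (ℝ ∙ u)ᗮ) : ⟪(z : F), u⟫ = 0 :=
  Submodule.mem_orthogonal_singleton_iff_inner_left.1 z.2

theorem coneSlice_subset_sphere (s : ℝ) : coneSlice o P K u s ⊆ sphere 0 1 :=
  fun z hz => by simpa using hz.1

theorem mem_coneSlice_zero {z : (ℝ ∙ u)ᗮ} :
    z ∈ coneSlice o P K u 0 ↔ ‖z‖ = 1 ∧ (z : F) ∈ coneOver o P K := by
  simp [coneSlice]

theorem inner_slice_eq (huo : ⟪u, o⟫ = 0) (z : (ℝ ∙ u)ᗮ) (s : ℝ) :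
    ⟪(z : F) + s • u, o⟫ = ⟪(z : F), o⟫ := by
  rw [inner_add_left, real_inner_smul_left, huo, mul_zero, add_zero]

theorem le_inner_of_mem_coneSlice (hP : ∀ y, ‖y‖ ^ 2 = ‖P y‖ ^ 2 + ⟪y, o⟫ ^ 2)
    (huo : ⟪u, o⟫ = 0) {B : ℝ} (hB : ∀ x ∈ K, ‖x‖ ≤ B) {s : ℝ} {z : (ℝ ∙ u)ᗮ}
    (hz : z ∈ coneSlice o P K u s) : (√(1 + B ^ 2))⁻¹ ≤ ⟪(z : F), o⟫ := by
  have h1 := norm_le_of_mem_coneOver hP hB hz.2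
  rw [inner_slice_eq huo] at h1
  have h2 : 1 ≤ ‖(z : F) + s • u‖ := by
    have h3 := norm_add_sq_real (z : F) (s • u)
    rw [real_inner_smul_right, inner_orthogonal_singleton] at h3
    have h4 : ‖(z : F)‖ = 1 := hz.1
    rw [h4] at h3
    nlinarith [sq_nonneg ‖s • u‖, norm_nonneg ((z : F) + s • u)]
  rw [inv_le_iff_one_le_mul₀ (by positivity), mul_comm]
  exact h2.trans h1

theorem isCompact_coneSlice [FiniteDimensional ℝ F] (hK : IsClosed K)
    (hP : ∀ y, ‖y‖ ^ 2 = ‖P y‖ ^ 2 + ⟪y, o⟫ ^ 2)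
    (huo : ⟪u, o⟫ = 0) {B : ℝ} (hB : ∀ x ∈ K, ‖x‖ ≤ B) (s : ℝ) :
    IsCompact (coneSlice o P K u s) := by
  have hc : 0 < (√(1 + B ^ 2))⁻¹ := by positivity
  have hcl := (isClosed_coneOver_ge (o := o) (P := P) hK hc).preimage
    (f := fun z : (ℝ ∙ u)ᗮ => (z : F) + s • u) (by fun_prop)
  have heq : coneSlice o P K u s = sphere (0 : (ℝ ∙ u)ᗮ) 1 ∩ (fun z : (ℝ ∙ u)ᗮ => (z : F) + s • u) ⁻¹'
      {y : F | (√(1 + B ^ 2))⁻¹ ≤ ⟪y, o⟫ ∧ y ∈ coneOver o P K} := by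
    ext z
    simp only [Set.mem_inter_iff, mem_sphere_zero_iff_norm, Set.mem_preimage, Set.mem_ofPred_eq,
      inner_slice_eq huo]
    exact ⟨fun h => ⟨h.1, le_inner_of_mem_coneSlice hP huo hB h, h.2⟩, fun h => ⟨h.1, h.2.2⟩⟩
  rw [heq]
  exact (isCompact_sphere 0 1).inter_right hcl

theorem normalize_add_mem_coneSlice (hK : Convex ℝ K) {s : ℝ} {z z' : (ℝ ∙ u)ᗮ}
    (hz : z ∈ coneSlice o P K u s) (hz' : z' ∈ coneSlice o P K u (-s)) :
    NormedSpace.normalize (z + z') ∈ coneSlice o P K u 0 := by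
  have h1 := coneOver_add_mem hK hz.2 hz'.2
  have h2 : (z : F) + s • u + (z' + (-s) • u) = ((z + z' : (ℝ ∙ u)ᗮ) : F) := by
    rw [neg_smul, Submodule.coe_add]
    abel
  rw [h2] at h1
  have h3 : z + z' ≠ 0 := by
    intro h
    rw [h] at h1
    simpa using h1.1
  exact mem_coneSlice_zero.2 ⟨NormedSpace.norm_normalize h3,
    coneOver_smul_mem (inv_pos.2 (norm_pos_iff.2 h3)) h1⟩

theorem reflection_mem_coneSlice_iff (ho : ‖o‖ = 1) (hPo : P o = 0) (huo : ⟪u, o⟫ = 0)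
    (hK : ∀ x ∈ K, -x ∈ K) {o' : (ℝ ∙ u)ᗮ} (ho' : (o' : F) = o) (s : ℝ) (z : (ℝ ∙ u)ᗮ) :
    (ℝ ∙ o').reflection z ∈ coneSlice o P K u s ↔ z ∈ coneSlice o P K u (-s) := by
  have key : ∀ (s : ℝ) (z : (ℝ ∙ u)ᗮ), z ∈ coneSlice o P K u (-s) →
      (ℝ ∙ o').reflection z ∈ coneSlice o P K u s := by
    intro s z hz
    refine ⟨by rw [LinearIsometryEquiv.norm_map]; exact hz.1, ?_⟩
    have h1 := coneOver_reflect_mem ho hPo hK hz.2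
    rw [inner_slice_eq huo] at h1
    convert h1 using 1
    have h2 : ‖o'‖ = 1 := by rw [← ho, ← ho']; rfl
    have h3 : ⟪o', z⟫ = ⟪(z : F), o⟫ := by rw [real_inner_comm, ← ho']; rfl
    rw [Submodule.reflection_singleton_apply, h2, h3, ← smul_assoc, nsmul_eq_mul, Nat.cast_ofNat]
    simp only [RCLike.ofReal_real_eq_id, id, one_pow, div_one, Submodule.coe_sub,
      Submodule.coe_smul, ho', neg_smul]
    abel
  refine ⟨fun h => ?_, key s z⟩
  rw [← neg_neg s] at h
  simpa using key _ _ h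

open Module in
theorem hausdorffMeasure_coneSlice_le [FiniteDimensional ℝ F] [MeasurableSpace F] [BorelSpace F]
    {m : ℕ} (hm : finrank ℝ (ℝ ∙ u)ᗮ = m + 1) (hK : IsClosed K)
    (hKc : Convex ℝ K) (hKs : ∀ x ∈ K, -x ∈ K) (ho : ‖o‖ = 1)
    (hP : ∀ y, ‖y‖ ^ 2 = ‖P y‖ ^ 2 + ⟪y, o⟫ ^ 2) (hPo : P o = 0)
    (huo : ⟪u, o⟫ = 0) {B : ℝ} (hB : ∀ x ∈ K, ‖x‖ ≤ B) (hK0 : 0 ∈ K) (s : ℝ) :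
    μH[m] (coneSlice o P K u s) ≤ μH[m] (coneSlice o P K u 0) := by
  have hoU : o ∈ (ℝ ∙ u)ᗮ := by
    rwa [Submodule.mem_orthogonal_singleton_iff_inner_left, real_inner_comm]
  set o' : (ℝ ∙ u)ᗮ := ⟨o, hoU⟩ with ho'
  have ho1 : ‖o'‖ = 1 := ho
  have hcomp := isCompact_coneSlice hK hP huo hB
  rcases m.eq_zero_or_pos with rfl | hm0
  · have hsub : (coneSlice o P K u s).Subsingleton := by
      refine Set.subsingleton_of_subset_singleton (a := o') fun z hz => ?_
      have hpos : 0 < ⟪(z : F), o⟫ := by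
        have := hz.2.1
        rwa [inner_slice_eq huo] at this
      obtain ⟨a, rfl⟩ := (finrank_eq_one_iff_of_nonzero' o' (norm_ne_zero_iff.1 (by simp [ho1]))).1
        hm z
      have h1 : |a| = 1 := by simpa [norm_smul, ho1] using hz.1
      have h2 : 0 < a := by
        have h3 : ⟪((a • o' : (ℝ ∙ u)ᗮ) : F), o⟫ = a := by
          simp [ho', real_inner_smul_left, ho]
        rwa [h3] at hpos
      rw [abs_of_pos h2] at h1
      simp [h1]
    refine (Measure.hausdorffMeasure_le_one_of_subsingleton hsub (by simp)).trans ?_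
    rw [Nat.cast_zero]
    refine Measure.one_le_hausdorffMeasure_zero_of_nonempty ⟨o', mem_coneSlice_zero.2 ⟨ho1, ?_, ?_⟩⟩
    · simp [ho', ho]
    · simpa [ho', hPo] using hK0
  obtain ⟨c, hc⟩ := exists_hausdorffMeasure_eq_mul hm
  rw [hc _ (coneSlice_subset_sphere s) (hcomp s).isClosed.measurableSet,
    hc _ (coneSlice_subset_sphere 0) (hcomp 0).isClosed.measurableSet]
  refine mul_le_mul' le_rfl ?_
  refine spherical_midpoint_inequality (by omega) (hcomp s) (hcomp (-s))
    (coneSlice_subset_sphere s) (coneSlice_subset_sphere (-s)) (hcomp 0).isClosed ho1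
    (c := (√(1 + B ^ 2))⁻¹) (by positivity) (fun z hz => le_inner_of_mem_coneSlice hP huo hB hz)
    (fun z hz => le_inner_of_mem_coneSlice hP huo hB hz)
    (fun z hz z' hz' => normalize_add_mem_coneSlice hKc hz hz') ?_
  rw [← (ℝ ∙ o').reflection.volume_normalize_preimage]
  congr 3
  ext z
  exact reflection_mem_coneSlice_iff ho hPo huo hKs rfl s z

open Module in
theorem hausdorffMeasure_coneSlice_closure_le [FiniteDimensional ℝ F] [MeasurableSpace F]
    [BorelSpace F] {m : ℕ} (hm : finrank ℝ (ℝ ∙ u)ᗮ = m + 1)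
    (hKc : Convex ℝ K) (ho : ‖o‖ = 1)
    (hP : ∀ y, ‖y‖ ^ 2 = ‖P y‖ ^ 2 + ⟪y, o⟫ ^ 2) (hPo : P o = 0)
    (huo : ⟪u, o⟫ = 0) {B : ℝ} (hB : ∀ x ∈ closure K, ‖x‖ ≤ B) (hK0 : 0 ∈ interior K) :
    μH[m] (coneSlice o P (closure K) u 0) ≤ μH[m] (coneSlice o P K u 0) := by
  have hoU : o ∈ (ℝ ∙ u)ᗮ := by
    rwa [Submodule.mem_orthogonal_singleton_iff_inner_left, real_inner_comm]
  obtain ⟨c, hc⟩ := exists_hausdorffMeasure_eq_mul hm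
  set Y : Set (ℝ ∙ u)ᗮ := {p | (p : F) ∈ coneOver o P K} with hY
  set N : Set (ℝ ∙ u)ᗮ := coneSlice o P (closure K) u 0 \ interior Y with hN
  have hNm : MeasurableSet N :=
    (isCompact_coneSlice isClosed_closure hP huo hB 0).isClosed.measurableSet.diff
      isOpen_interior.measurableSet
  have hN0 : μH[m] N = 0 := by
    rw [hc N (Set.sdiff_subset.trans (coneSlice_subset_sphere 0)) hNm]
    suffices h : ball (0 : (ℝ ∙ u)ᗮ) 1 ∩ NormedSpace.normalize ⁻¹' N ⊆ frontier Y by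
      rw [measure_mono_null h ((convex_coneOver_preimage hKc).addHaar_frontier volume), mul_zero]
    rintro p ⟨-, hp⟩
    have hp1 := (mem_coneSlice_zero.1 hp.1)
    have hp0 : 0 < ‖p‖ := by
      refine norm_pos_iff.2 fun h => ?_
      simp [h] at hp1
    refine ⟨mem_closure_of_mem_coneOver_closure ho hPo hoU hKc hK0
      ((coneOver_smul_mem_iff (inv_pos.2 hp0)).1 hp1.2), fun h => hp.2 ?_⟩
    exact smul_mem_interior_coneOver_preimage h (inv_pos.2 hp0)
  have hsub : coneSlice o P (closure K) u 0 ⊆ N ∪ coneSlice o P K u 0 := by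
    intro z hz
    by_cases h : z ∈ interior Y
    · exact Or.inr (mem_coneSlice_zero.2 ⟨hz.1, interior_subset (s := Y) h⟩)
    · exact Or.inl ⟨hz, h⟩
  calc μH[m] (coneSlice o P (closure K) u 0) ≤ μH[m] (N ∪ coneSlice o P K u 0) :=
        measure_mono hsub
    _ ≤ μH[m] N + μH[m] (coneSlice o P K u 0) := measure_union_le _ _
    _ = μH[m] (coneSlice o P K u 0) := by rw [hN0, zero_add]

theorem hausdorffMeasure_section_le [MeasurableSpace F] [BorelSpace F] {d : ℝ} (hd : 0 ≤ d)
    (hu : ‖u‖ = 1) {t : ℝ} (ht : 0 < cos t) :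
    μH[d] {y | ‖y‖ = 1 ∧ y ∈ coneOver o P K ∧ ⟪y, u⟫ = sin t} ≤
      μH[d] (coneSlice o P K u (tan t)) := by
  set f : (ℝ ∙ u)ᗮ → F := fun z => cos t • (z : F) + sin t • u with hf
  have hLip : LipschitzWith 1 f := by
    refine LipschitzWith.of_dist_le_mul fun z w => ?_
    rw [NNReal.coe_one, one_mul, dist_eq_norm, dist_eq_norm]
    have h1 : f z - f w = cos t • ((z - w : (ℝ ∙ u)ᗮ) : F) := by
      simp only [hf, Submodule.coe_sub, smul_sub]
      abel
    rw [h1, norm_smul, Real.norm_eq_abs]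
    exact mul_le_of_le_one_left (norm_nonneg _) (abs_cos_le_one t)
  have hsub : {y | ‖y‖ = 1 ∧ y ∈ coneOver o P K ∧ ⟪y, u⟫ = sin t} ⊆
      f '' coneSlice o P K u (tan t) := by
    rintro y ⟨hy1, hyK, hyu⟩
    have hmem : (cos t)⁻¹ • (y - sin t • u) ∈ (ℝ ∙ u)ᗮ := by
      rw [Submodule.mem_orthogonal_singleton_iff_inner_left, real_inner_smul_left, inner_sub_left,
        real_inner_smul_left, real_inner_self_eq_norm_sq, hu, hyu]
      ring
    refine ⟨⟨_, hmem⟩, ⟨?_, ?_⟩, ?_⟩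
    · change ‖(cos t)⁻¹ • (y - sin t • u)‖ = 1
      rw [norm_smul, norm_inv, Real.norm_eq_abs, abs_of_pos ht, inv_mul_eq_one₀ ht.ne']
      refine (pow_left_inj₀ ht.le (norm_nonneg _) two_ne_zero).1 ?_
      rw [norm_sub_sq_real, real_inner_smul_right, hyu, norm_smul, hu, hy1, Real.norm_eq_abs,
        mul_one, sq_abs]
      nlinarith [sin_sq_add_cos_sq t]
    · convert coneOver_smul_mem (inv_pos.2 ht) hyK using 1
      change (cos t)⁻¹ • (y - sin t • u) + tan t • u = _
      rw [tan_eq_sin_div_cos, smul_sub, smul_smul, div_eq_inv_mul]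
      abel
    · simp only [hf]
      rw [smul_inv_smul₀ ht.ne']
      abel
  refine (measure_mono hsub).trans ((hLip.hausdorffMeasure_image_le hd _).trans ?_)
  simp

theorem hausdorffMeasure_coneSlice_zero_le [MeasurableSpace F] [BorelSpace F] {d : ℝ}
    (hd : 0 ≤ d) :
    μH[d] (coneSlice o P K u 0) ≤ μH[d] {y | ‖y‖ = 1 ∧ y ∈ coneOver o P K ∧ ⟪y, u⟫ = 0} := by
  have h := (ℝ ∙ u)ᗮ.subtypeₗᵢ.isometry.hausdorffMeasure_image (Or.inl hd) (coneSlice o P K u 0)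
  rw [← h]
  refine measure_mono ?_
  rintro _ ⟨z, hz, rfl⟩
  have := mem_coneSlice_zero.1 hz
  exact ⟨this.1, this.2, inner_orthogonal_singleton z⟩

end Slice
/-- Orthogonal projection of `ℝⁿ⁺¹` onto the first `n` coordinates. -/
noncomputable def initCLM (n : ℕ) :
    EuclideanSpace ℝ (Fin (n + 1)) →L[ℝ] EuclideanSpace ℝ (Fin n) :=
  LinearMap.toContinuousLinearMap
    { toFun := fun y => WithLp.toLp 2 fun i => y i.castSucc
      map_add' := fun _ _ => rfl
      map_smul' := fun _ _ => rfl }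

theorem initCLM_apply {n : ℕ} (y : EuclideanSpace ℝ (Fin (n + 1))) (i : Fin n) :
    initCLM n y i = y i.castSucc := rfl

theorem inner_pole {n : ℕ} (y : EuclideanSpace ℝ (Fin (n + 1))) :
    ⟪y, pole n⟫ = y (Fin.last n) := by
  simp [pole, EuclideanSpace.inner_single_right]

theorem norm_pole (n : ℕ) : ‖pole n‖ = 1 := by
  simp [pole]

theorem norm_sq_eq_initCLM {n : ℕ} (y : EuclideanSpace ℝ (Fin (n + 1))) :
    ‖y‖ ^ 2 = ‖initCLM n y‖ ^ 2 + ⟪y, pole n⟫ ^ 2 := by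
  rw [EuclideanSpace.real_norm_sq_eq, EuclideanSpace.real_norm_sq_eq, Fin.sum_univ_castSucc,
    inner_pole]
  rfl

theorem initCLM_pole (n : ℕ) : initCLM n (pole n) = 0 := by
  ext i
  simp [initCLM_apply, pole]

theorem gnomonic_apply_castSucc {n : ℕ} (x : EuclideanSpace ℝ (Fin n)) (i : Fin n) :
    gnomonic n x i.castSucc = (√(1 + ‖x‖ ^ 2))⁻¹ * x i := by
  simp [gnomonic]

theorem gnomonic_apply_last {n : ℕ} (x : EuclideanSpace ℝ (Fin n)) :
    gnomonic n x (Fin.last n) = (√(1 + ‖x‖ ^ 2))⁻¹ := by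
  simp [gnomonic]

theorem initCLM_gnomonic {n : ℕ} (x : EuclideanSpace ℝ (Fin n)) :
    initCLM n (gnomonic n x) = (√(1 + ‖x‖ ^ 2))⁻¹ • x := by
  ext i
  simp [initCLM_apply, gnomonic_apply_castSucc]

theorem image_gnomonic {n : ℕ} (K : Set (EuclideanSpace ℝ (Fin n))) :
    gnomonic n '' K = {y | ‖y‖ = 1 ∧ y ∈ coneOver (pole n) (initCLM n) K} := by
  ext y
  constructor
  · rintro ⟨x, hx, rfl⟩
    have hpos : 0 < √(1 + ‖x‖ ^ 2) := by positivity
    refine ⟨?_, ?_, ?_⟩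
    · rw [← sq_eq_sq₀ (norm_nonneg _) zero_le_one, norm_sq_eq_initCLM, inner_pole,
        gnomonic_apply_last, initCLM_gnomonic, norm_smul, mul_pow, norm_inv, inv_pow, inv_pow,
        Real.norm_eq_abs, sq_abs, Real.sq_sqrt (by positivity)]
      field_simp
      ring
    · rw [inner_pole, gnomonic_apply_last]
      positivity
    · rwa [inner_pole, gnomonic_apply_last, initCLM_gnomonic, inv_inv, smul_inv_smul₀ hpos.ne']
  · rintro ⟨hy1, hy0, hyK⟩
    refine ⟨_, hyK, ?_⟩
    have hs := norm_sq_eq_initCLM y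
    rw [hy1] at hs
    have hsq : √(1 + ‖⟪y, pole n⟫⁻¹ • initCLM n y‖ ^ 2) = ⟪y, pole n⟫⁻¹ := by
      rw [Real.sqrt_eq_iff_mul_self_eq_of_pos (inv_pos.2 hy0), norm_smul, mul_pow,
        Real.norm_eq_abs, sq_abs]
      field_simp
      linarith
    ext i
    refine Fin.lastCases ?_ (fun j => ?_) i
    · rw [gnomonic_apply_last, hsq, inv_inv, inner_pole]
    · rw [gnomonic_apply_castSucc, hsq, PiLp.smul_apply, initCLM_apply, smul_eq_mul, inv_inv,
        mul_inv_cancel_left₀ hy0.ne']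

theorem Convex.zero_mem_interior_of_neg_mem {E : Type*} [NormedAddCommGroup E] [NormedSpace ℝ E]
    {K : Set E} (hK : Convex ℝ K) (hsym : K = -K) (hne : (interior K).Nonempty) :
    0 ∈ interior K := by
  obtain ⟨x, hx⟩ := hne
  have hx' : -x ∈ interior K := by
    have h : interior K = -interior K := by
      conv_lhs => rw [hsym]
      exact ((Homeomorph.neg E).preimage_interior K).symm
    rw [h]
    simpa using hx
  have := hK.interior hx hx' (a := 1 / 2) (b := 1 / 2) (by norm_num) (by norm_num) (by norm_num)
  simpa using this

/-- Among the parallel family of hyperspheres `{y ∈ Sⁿ : ⟪y,u⟫ = sin t}`,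
the central one (through the pole `o`) cuts the gnomonic image of a bounded symmetric
convex body in maximal `(n-1)`-dimensional section. -/
theorem central_section_maximal (n : ℕ) (hn : 1 ≤ n)
    (K₀ : Set (EuclideanSpace ℝ (Fin n))) (hK₀conv : Convex ℝ K₀) (hK₀sym : K₀ = -K₀)
    (hK₀bdd : Bornology.IsBounded K₀) (hK₀int : (interior K₀).Nonempty)
    (u : EuclideanSpace ℝ (Fin (n + 1))) (hu : ‖u‖ = 1) (huo : ⟪u, pole n⟫ = 0)
    (t : ℝ) (ht : t ∈ Set.Ioo (-(π / 2)) (π / 2)) :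
    μH[(n : ℝ) - 1] ((gnomonic n '' K₀) ∩ {y | ⟪y, u⟫ = 0}) ≥
      μH[(n : ℝ) - 1] ((gnomonic n '' K₀) ∩ {y | ⟪y, u⟫ = Real.sin t}) := by
  obtain ⟨m, rfl⟩ := Nat.exists_eq_add_of_le' hn
  have hcast : ((m + 1 : ℕ) : ℝ) - 1 = (m : ℕ) := by push_cast; ring
  have hm : Module.finrank ℝ (ℝ ∙ u)ᗮ = m + 1 := by
    have : Fact (Module.finrank ℝ (EuclideanSpace ℝ (Fin (m + 1 + 1))) = m + 1 + 1) := ⟨by simp⟩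
    exact Submodule.finrank_orthogonal_span_singleton (norm_ne_zero_iff.1 (by simp [hu]))
  obtain ⟨B, hB⟩ := hK₀bdd.closure.exists_norm_le
  have h0 := hK₀conv.zero_mem_interior_of_neg_mem hK₀sym hK₀int
  have hneg : ∀ x ∈ closure K₀, -x ∈ closure K₀ := fun x hx =>
    map_mem_closure continuous_neg hx fun y hy => by rw [hK₀sym]; simpa using hy
  have hd : (0 : ℝ) ≤ (m : ℕ) := Nat.cast_nonneg m
  have hassoc : ∀ r : ℝ, gnomonic (m + 1) '' K₀ ∩ {y | ⟪y, u⟫ = r} =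
      {y | ‖y‖ = 1 ∧ y ∈ coneOver (pole (m + 1)) (initCLM (m + 1)) K₀ ∧ ⟪y, u⟫ = r} := by
    intro r
    rw [image_gnomonic]
    ext y
    exact and_assoc
  rw [hcast, hassoc, hassoc, ge_iff_le]
  calc _ ≤ μH[(m : ℕ)] (coneSlice (pole (m + 1)) (initCLM (m + 1)) K₀ u (tan t)) :=
        hausdorffMeasure_section_le hd hu (cos_pos_of_mem_Ioo ht)
    _ ≤ μH[(m : ℕ)] (coneSlice (pole (m + 1)) (initCLM (m + 1)) (closure K₀) u (tan t)) :=
        measure_mono fun z hz => ⟨hz.1, hz.2.1, subset_closure hz.2.2⟩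
    _ ≤ μH[(m : ℕ)] (coneSlice (pole (m + 1)) (initCLM (m + 1)) (closure K₀) u 0) :=
        hausdorffMeasure_coneSlice_le hm isClosed_closure hK₀conv.closure hneg (norm_pole _)
          norm_sq_eq_initCLM (initCLM_pole _) huo hB (subset_closure (interior_subset h0)) _
    _ ≤ μH[(m : ℕ)] (coneSlice (pole (m + 1)) (initCLM (m + 1)) K₀ u 0) :=
        hausdorffMeasure_coneSlice_closure_le hm hK₀conv (norm_pole _) norm_sq_eq_initCLM
          (initCLM_pole _) huo hB h0
    _ ≤ _ := hausdorffMeasure_coneSlice_zero_le hd
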